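/- arXiv:1611.08488 — 5 statements merged into one kernel-verified Lean document; each statement's English description precedes it below -/
import Mathlib

section
/- Let X be a compact metric space with topological dimension dim X ≤ d and let T : X → X be a positively cw-expansive continuous map. If T is locally injective, then the set of f ∈ C(X, ℝ) that observe T on (X × X) \ Δ_{2d}(T) in 2d steps is residual (comeager) in C(X, ℝ). -/
open Set Topology Function Metric

/-- `CovDimLE X d` : the topological (Lebesgue covering) dimension of `X` is at most `d`. -/
def CovDimLE (X : Type*) [TopologicalSpace X] (d : ℕ) : Prop :=
  ∀ 𝒰 : Set (Set X), (∀ U ∈ 𝒰, IsOpen U) → ⋃₀ 𝒰 = Set.univ →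
    ∃ 𝒱 : Set (Set X), (∀ V ∈ 𝒱, IsOpen V) ∧ ⋃₀ 𝒱 = Set.univ ∧
      (∀ V ∈ 𝒱, ∃ U ∈ 𝒰, V ⊆ U) ∧
      ∀ x : X, {V ∈ 𝒱 | x ∈ V}.Finite ∧ Nat.card {V ∈ 𝒱 | x ∈ V} ≤ d + 1

/-- A finite family of reals can be perturbed to an injective family avoiding zero. -/
theorem exists_injective_ne_zero_near {ι : Type*} [Finite ι] (a : ι → ℝ) {ε : ℝ} (hε : 0 < ε) :
    ∃ c : ι → ℝ, Injective c ∧ (∀ i, c i ≠ 0) ∧ ∀ i, |c i - a i| ≤ ε := by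
  obtain ⟨n, ⟨e⟩⟩ := Finite.exists_equiv_fin ι
  set m : ι → ℝ := fun i => (e i : ℕ) + 1 with hm
  have hm0 : ∀ i, 0 < m i := fun i => by positivity
  have hmn : ∀ i, m i ≤ n := fun i => by
    have := (e i).2
    simp only [hm]; exact_mod_cast this
  have hminj : Injective m := fun i j h => by
    simp only [hm, add_left_inj, Nat.cast_inj] at h
    exact e.injective (Fin.ext h)
  have hfin : ((⋃ p : ι × ι, {θ : ℝ | p.1 ≠ p.2 ∧ a p.1 + θ * m p.1 = a p.2 + θ * m p.2}) ∪
      ⋃ i, {θ : ℝ | a i + θ * m i = 0}).Finite := by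
    refine (finite_iUnion fun p => Set.Subsingleton.finite ?_).union
      (finite_iUnion fun i => Set.Subsingleton.finite ?_)
    · rintro θ ⟨hne, h⟩ θ' ⟨-, h'⟩
      have : (θ - θ') * (m p.1 - m p.2) = 0 := by linarith
      rcases mul_eq_zero.1 this with h | h
      · linarith
      · exact absurd (hminj (by linarith)) hne
    · intro θ h θ' h'
      simp only [mem_ofPred_eq] at h h'
      have : (θ - θ') * m i = 0 := by linarith
      rcases mul_eq_zero.1 this with h | h
      · linarith
      · exact absurd h (hm0 i).ne'
  obtain ⟨θ, ⟨hθ0, hθ1⟩, hθ⟩ :=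
    ((Ioo_infinite (show (0 : ℝ) < ε / (n + 1) by positivity)).sdiff hfin).nonempty
  simp only [mem_union, mem_iUnion, mem_ofPred_eq, not_or, not_exists, not_and] at hθ
  refine ⟨fun i => a i + θ * m i, fun i j hij => ?_, hθ.2, fun i => ?_⟩
  · by_contra hne
    exact hθ.1 (i, j) hne hij
  · rw [add_sub_cancel_left, abs_of_nonneg (mul_nonneg hθ0.le (hm0 i).le)]
    rw [lt_div_iff₀ (by positivity)] at hθ1
    nlinarith [hmn i]

/-- If a closed set `D` is covered by finitely many relatively clopen sets on each of which `f`
oscillates little, then `f` is close to a function that has no zero on `D` and separates any two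
points of `D` that do not lie in a common set of the cover. -/
theorem exists_near_separating {X : Type*} [TopologicalSpace X] [CompactSpace X] [NormalSpace X]
    {D : Set X} (hD : IsClosed D) {ι : Type*} [Finite ι] (U : ι → Set X)
    (hU : ∀ i, IsClopen (Subtype.val ⁻¹' U i : Set D)) (hcov : D ⊆ ⋃ i, U i)
    (f : C(X, ℝ)) {ε : ℝ} (hε : 0 < ε)
    (hosc : ∀ i, ∀ x ∈ D ∩ U i, ∀ y ∈ D ∩ U i, |f x - f y| ≤ ε) :
    ∃ g : C(X, ℝ), dist g f ≤ 2 * ε ∧ (∀ x ∈ D, g x ≠ 0) ∧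
      ∀ x ∈ D, ∀ y ∈ D, g x = g y → ∃ i, x ∈ U i ∧ y ∈ U i := by
  classical
  have : CompactSpace D := isCompact_iff_compactSpace.1 hD.isCompact
  let σ : D → Set ι := fun x => {i | (x : X) ∈ U i}
  have hσ : IsLocallyConstant σ := by
    rw [IsLocallyConstant.iff_eventually_eq]
    intro x
    have : ∀ i, ∀ᶠ y : D in 𝓝 x, ((y : X) ∈ U i ↔ (x : X) ∈ U i) := by
      intro i
      by_cases hx : (x : X) ∈ U i
      · filter_upwards [(hU i).isOpen.mem_nhds hx] with y hy using iff_of_true hy hx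
      · filter_upwards [(hU i).isClosed.isOpen_compl.mem_nhds hx] with y hy using iff_of_false hy hx
    filter_upwards [Filter.eventually_all.2 this] with y hy
    ext i
    exact hy i
  obtain ⟨c, hcinj, hc0, hc⟩ := exists_injective_ne_zero_near
    (fun s : Set ι => if h : ∃ x, σ x = s then f (h.choose : D) else 0) hε
  have hnear : ∀ x : D, |c (σ x) - f x| ≤ 2 * ε := by
    intro x
    have hex : ∃ y, σ y = σ x := ⟨x, rfl⟩
    have h1 := hc (σ x)
    rw [dif_pos hex] at h1
    obtain ⟨i, hi⟩ := mem_iUnion.1 (hcov x.2)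
    have hi' : i ∈ σ hex.choose := by rw [hex.choose_spec]; exact hi
    have h2 := hosc i _ ⟨hex.choose.2, hi'⟩ _ ⟨x.2, hi⟩
    calc |c (σ x) - f x| = |(c (σ x) - f hex.choose) + (f hex.choose - f x)| := by ring_nf
      _ ≤ _ := abs_add_le _ _
      _ ≤ _ := by linarith
  have hcont : Continuous fun x : D => c (σ x) - f x :=
    ((hσ.comp c).continuous).sub (f.continuous.comp continuous_subtype_val)
  obtain ⟨q, hq, hqD⟩ := BoundedContinuousFunction.exists_norm_eq_domRestrict_eq_of_closed
    (BoundedContinuousFunction.mkOfCompact ⟨_, hcont⟩) hD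
  have hqnorm : ‖q‖ ≤ 2 * ε := by
    rw [hq, BoundedContinuousFunction.norm_le (by positivity)]
    exact hnear
  have hval : ∀ x (hx : x ∈ D), f x + q x = c (σ ⟨x, hx⟩) := by
    intro x hx
    have h := DFunLike.congr_fun hqD ⟨x, hx⟩
    have h' : q x = c (σ ⟨x, hx⟩) - f x := h
    rw [h']; ring
  refine ⟨f + q.toContinuousMap, ?_, fun x hx => ?_, fun x hx y hy hxy => ?_⟩
  · rw [ContinuousMap.dist_le (by positivity)]
    intro x
    have := (q.norm_coe_le_norm x).trans hqnorm
    simpa [Real.dist_eq] using this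
  · exact (hval x hx).trans_ne (hc0 _)
  · have h : c (σ ⟨x, hx⟩) = c (σ ⟨y, hy⟩) := by
      rw [← hval, ← hval]; exact hxy
    obtain ⟨i, hi⟩ := mem_iUnion.1 (hcov hx)
    have hs := hcinj h
    have : i ∈ σ ⟨y, hy⟩ := hs ▸ (show i ∈ σ ⟨x, hx⟩ from hi)
    exact ⟨i, hi, this⟩

/-- A compact space of covering dimension at most `d` has finite open covers of multiplicity at
most `d + 1` refining any given open cover. -/
theorem CovDimLE.exists_finite_refinement {X : Type*} [TopologicalSpace X] [CompactSpace X]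
    {d : ℕ} (hdim : CovDimLE X d) (𝒰 : Set (Set X)) (h𝒰 : ∀ U ∈ 𝒰, IsOpen U)
    (hcov : ⋃₀ 𝒰 = univ) :
    ∃ 𝒱 : Finset (Set X), (∀ V ∈ 𝒱, IsOpen V) ∧ (∀ x, ∃ V ∈ 𝒱, x ∈ V) ∧
      (∀ V ∈ 𝒱, ∃ U ∈ 𝒰, V ⊆ U) ∧
      ∀ x, ∀ S : Finset (Set X), S ⊆ 𝒱 → (∀ V ∈ S, x ∈ V) → S.card ≤ d + 1 := by
  obtain ⟨𝒱, ho, hc, hr, hd⟩ := hdim 𝒰 h𝒰 hcov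
  obtain ⟨t, ht, htc⟩ := isCompact_univ.elim_finite_subcover_image (b := 𝒱) (c := id) ho
    (by rw [← hc, sUnion_eq_biUnion]; rfl)
  lift t to Finset (Set X) using htc.1
  refine ⟨t, fun V hV => ho V (ht hV), fun x => ?_, fun V hV => hr V (ht hV), fun x S hS hx => ?_⟩
  · simpa using htc.2 (mem_univ x)
  · rw [← Set.ncard_coe_finset]
    refine (Set.ncard_le_ncard ?_ (hd x).1).trans (hd x).2
    exact fun V hV => ⟨ht (hS hV), hx V hV⟩

/-- On a compact space of dimension at most `d`, any finite family of functions can be perturbed so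
that at most `d` of them vanish at any given point. -/
theorem CovDimLE.exists_near_card_zeros_le {X : Type*} [TopologicalSpace X] [CompactSpace X]
    [T2Space X] {d : ℕ} (hdim : CovDimLE X d) {J : Type*} [Finite J] (F : J → C(X, ℝ)) {ε : ℝ}
    (hε : 0 < ε) :
    ∃ G : J → C(X, ℝ), (∀ j, dist (G j) (F j) ≤ ε) ∧
      ∀ x, ∀ S : Finset J, (∀ j ∈ S, G j x = 0) → S.card ≤ d := by
  classical
  obtain ⟨𝒱, ho, hc, hr, hd⟩ := hdim.exists_finite_refinement
    {U | IsOpen U ∧ ∀ j, ∀ x ∈ U, ∀ y ∈ U, |F j x - F j y| ≤ ε / 2} (fun U hU => hU.1) (by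
      refine eq_univ_of_forall fun x => ?_
      refine ⟨⋂ j, {y | |F j y - F j x| < ε / 4},
        ⟨isOpen_iInter_of_finite fun j => isOpen_lt (by fun_prop) continuous_const,
          fun j y hy z hz => ?_⟩, mem_iInter.2 fun j => ?_⟩
      · have h1 : |F j y - F j x| < ε / 4 := mem_iInter.1 hy j
        have h2 : |F j z - F j x| < ε / 4 := mem_iInter.1 hz j
        rw [abs_lt] at h1 h2
        rw [abs_le]
        constructor <;> linarith
      · show |F j x - F j x| < ε / 4
        simpa using hε)
  obtain ⟨φ, hφ⟩ := PartitionOfUnity.exists_isSubordinate isClosed_univ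
    (fun i : 𝒱 => (i : Set X)) (fun i => ho i i.2)
    (fun x _ => by obtain ⟨V, hV, hx⟩ := hc x; exact mem_iUnion.2 ⟨⟨V, hV⟩, hx⟩)
  have hmem : ∀ (i : 𝒱) x, φ i x ≠ 0 → x ∈ (i : Set X) :=
    fun i x h => hφ i (subset_tsupport _ h)
  set lam : ℝ := 1 / (Fintype.card 𝒱 + 1) with hlam
  have hlam0 : 0 < lam := by positivity
  have hbig : ∀ x, ∃ i, lam ≤ φ i x := by
    intro x
    by_contra! h
    have h1 : ∑ i, φ i x = 1 := by
      rw [← finsum_eq_sum_of_fintype]; exact φ.sum_eq_one (mem_univ x)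
    have h2 : ∑ i, φ i x ≤ ∑ i : 𝒱, lam := Finset.sum_le_sum fun i _ => (h i).le
    rw [h1, Finset.sum_const, Finset.card_univ, nsmul_eq_mul, hlam, mul_one_div,
      le_div_iff₀ (by positivity)] at h2
    linarith
  obtain ⟨m, ⟨e⟩⟩ := Finite.exists_equiv_fin J
  set τ : ℝ := lam / (2 * (m + 1)) with hτ
  have hτ0 : 0 < τ := by positivity
  have hτm : 2 * τ * (m + 1) = lam := by rw [hτ]; field_simp
  set t : J → ℝ := fun j => 2 * τ * ((e j : ℕ) + 1) with ht
  have ht0 : ∀ j, 0 < t j := fun j => by positivity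
  have htlam : ∀ j, t j + τ < lam := fun j => by
    have : ((e j : ℕ) : ℝ) + 1 ≤ m := by exact_mod_cast (e j).2
    simp only [ht]
    nlinarith
  have htinj : ∀ j k, |t j - t k| < 2 * τ → j = k := by
    intro j k h
    simp only [ht] at h
    rw [← mul_sub, add_sub_add_right_eq_sub, abs_mul, abs_of_pos (by positivity : 0 < 2 * τ)] at h
    have h1 : |((e j : ℕ) : ℝ) - (e k : ℕ)| < 1 := by nlinarith
    have h2 : |((e j : ℕ) : ℤ) - (e k : ℕ)| < 1 := by exact_mod_cast h1
    rw [Int.abs_lt_one_iff] at h2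
    exact e.injective (Fin.ext (by omega))
  have key : ∀ j, ∃ g : C(X, ℝ), dist g (F j) ≤ 2 * (ε / 2) ∧
      ∀ x ∈ {x | ∀ i, τ ≤ |φ i x - t j|}, g x ≠ 0 := by
    intro j
    obtain ⟨g, hg, hg0, -⟩ := exists_near_separating (D := {x | ∀ i, τ ≤ |φ i x - t j|})
      (by
        simp only [ofPred_forall]
        exact isClosed_iInter fun i => isClosed_le continuous_const (by fun_prop))
      (fun i => {x | t j < φ i x})
      (fun i => by
        refine ⟨⟨?_⟩, (isOpen_lt continuous_const (φ i).continuous).preimage continuous_subtype_val⟩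
        convert isOpen_lt (f := fun x : {x | ∀ i, τ ≤ |φ i x - t j|} => φ i x)
          (g := fun _ => t j) (by fun_prop) continuous_const using 1
        ext x
        have h1 := x.2 i
        have : φ i x ≠ t j := fun h => by
          rw [h, sub_self, abs_zero] at h1; linarith
        simp [le_iff_lt_or_eq, this])
      (fun x _ => by
        obtain ⟨i, hi⟩ := hbig x
        exact mem_iUnion.2 ⟨i, show t j < φ i x by linarith [htlam j]⟩)
      (F j) (half_pos hε)
      (fun i x hx y hy => by
        obtain ⟨U, hU, hVU⟩ := hr i i.2
        have hx' : t j < φ i x := hx.2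
        have hy' : t j < φ i y := hy.2
        exact hU.2 j x (hVU (hmem i x ((ht0 j).trans hx').ne'))
          y (hVU (hmem i y ((ht0 j).trans hy').ne')))
    exact ⟨g, hg, hg0⟩
  choose G hG hG0 using key
  refine ⟨G, fun j => (hG j).trans (by linarith), fun x S hS => ?_⟩
  have hwall : ∀ j ∈ S, ∃ i, |φ i x - t j| < τ := by
    intro j hj
    by_contra! h
    exact hG0 j x h (hS j hj)
  obtain ⟨i₀, hi₀⟩ := hbig x
  have : Nonempty 𝒱 := ⟨i₀⟩
  choose! i hi using hwall
  have hinj : Set.InjOn i S := by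
    intro j hj k hk hjk
    have h1 := hi j hj
    have h2 := hi k hk
    rw [← hjk] at h2
    apply htinj
    rw [abs_lt] at h1 h2 ⊢
    constructor <;> linarith
  have hni₀ : i₀ ∉ S.image i := by
    intro h
    obtain ⟨j, hj, rfl⟩ := Finset.mem_image.1 h
    have := (abs_lt.1 (hi j hj)).2
    linarith [htlam j]
  have hcard := hd x ((insert i₀ (S.image i)).map (Embedding.subtype _))
    (fun V hV => by
      obtain ⟨W, -, rfl⟩ := Finset.mem_map.1 hV
      exact W.2)
    (fun V hV => by
      obtain ⟨W, hW, rfl⟩ := Finset.mem_map.1 hV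
      apply hmem W x
      rcases Finset.mem_insert.1 hW with rfl | hW
      · exact (hlam0.trans_le hi₀).ne'
      · obtain ⟨j, hj, rfl⟩ := Finset.mem_image.1 hW
        have h1 := (abs_lt.1 (hi j hj)).1
        have h2 : 2 * τ ≤ t j := by
          simp only [ht]
          have : (0 : ℝ) ≤ (e j : ℕ) := by positivity
          nlinarith
        exact ne_of_gt (by linarith))
  rw [Finset.card_map, Finset.card_insert_of_notMem hni₀, Finset.card_image_of_injOn hinj] at hcard
  omega

/-- A closed subset of a compact metric space whose points have arbitrarily small relatively clopen
neighborhoods: every continuous function can be perturbed to have no zero on it. -/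
theorem exists_near_ne_zero_of_clopen_nhds {X : Type*} [TopologicalSpace X] [CompactSpace X]
    [NormalSpace X] {E : Set X} (hE : IsClosed E)
    (hcl : ∀ x ∈ E, ∀ U ∈ 𝓝 x, ∃ V ⊆ U, x ∈ V ∧ IsClopen (Subtype.val ⁻¹' V : Set E))
    (f : C(X, ℝ)) {ε : ℝ} (hε : 0 < ε) :
    ∃ g : C(X, ℝ), dist g f ≤ ε ∧ ∀ x ∈ E, g x ≠ 0 := by
  have : CompactSpace E := isCompact_iff_compactSpace.1 hE.isCompact
  have hU : ∀ x : E, {y | |f y - f x| < ε / 4} ∈ 𝓝 (x : X) := fun x =>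
    (isOpen_lt (by fun_prop) continuous_const).mem_nhds (by simpa using hε)
  choose V hVU hxV hV using fun x : E => hcl x x.2 _ (hU x)
  obtain ⟨t, ht⟩ := CompactSpace.elim_nhds_subcover (fun x : E => (Subtype.val ⁻¹' V x : Set E))
    (fun x => (hV x).isOpen.mem_nhds (hxV x))
  obtain ⟨g, hg, hg0, -⟩ := exists_near_separating hE (fun i : t => V i) (fun i => hV i)
    (fun x hx => by
      have : (⟨x, hx⟩ : E) ∈ ⋃ x ∈ t, (Subtype.val ⁻¹' V x : Set E) := ht ▸ mem_univ _
      obtain ⟨i, hi, hxi⟩ := mem_iUnion₂.1 this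
      exact mem_iUnion.2 ⟨⟨i, hi⟩, hxi⟩) f (half_pos hε)
    (fun i x hx y hy => by
      have h1 : |f x - f i| < ε / 4 := hVU i hx.2
      have h2 : |f y - f i| < ε / 4 := hVU i hy.2
      rw [abs_lt] at h1 h2
      rw [abs_le]
      constructor <;> linarith)
  exact ⟨g, hg.trans (by linarith), hg0⟩

/-- If the small subcontinua of a closed set are trivial, then its points have arbitrarily small
relatively clopen neighborhoods. -/
theorem exists_clopen_nhd_of_small_continua_subsingleton {X : Type*} [MetricSpace X]
    [CompactSpace X] {E : Set X} (hE : IsClosed E) {r : ℝ} (hr : 0 < r)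
    (hcont : ∀ C ⊆ E, IsCompact C → IsConnected C → (∀ x ∈ C, ∀ y ∈ C, dist x y < r) →
      C.Subsingleton) :
    ∀ x ∈ E, ∀ U ∈ 𝓝 x, ∃ V ⊆ U, x ∈ V ∧ IsClopen (Subtype.val ⁻¹' V : Set E) := by
  intro x hx U hU
  obtain ⟨s, hs, hsU⟩ := Metric.nhds_basis_closedBall.mem_iff.1 hU
  set ρ := min s (r / 3) with hρ
  have hρ0 : 0 < ρ := by positivity
  set K := E ∩ closedBall x ρ with hK
  have hKc : IsClosed K := hE.inter isClosed_closedBall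
  have hKd : IsTotallyDisconnected K := by
    intro t htK ht
    rcases t.eq_empty_or_nonempty with rfl | hne
    · exact subsingleton_empty
    have hcl : closure t ⊆ K := hKc.closure_subset_iff.2 htK
    refine (hcont (closure t) (hcl.trans inter_subset_left) isClosed_closure.isCompact
      ⟨hne.closure, ht.closure⟩ fun y hy z hz => ?_).anti subset_closure
    have h1 := mem_closedBall.1 (hcl hy).2
    have h2 := mem_closedBall'.1 (hcl hz).2
    have h3 : ρ ≤ r / 3 := min_le_right _ _
    linarith [dist_triangle y x z]
  have : TotallyDisconnectedSpace K := totallyDisconnectedSpace_subtype_iff.2 hKd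
  have : CompactSpace K := isCompact_iff_compactSpace.1 hKc.isCompact
  obtain ⟨W, hW, hxW, hWb⟩ := compact_exists_isClopen_in_isOpen
    (x := (⟨x, hx, mem_closedBall_self hρ0.le⟩ : K)) (U := Subtype.val ⁻¹' ball x ρ)
    (isOpen_ball.preimage continuous_subtype_val) (mem_ball_self hρ0)
  refine ⟨Subtype.val '' W, ?_, ⟨_, hxW, rfl⟩, ?_, ?_⟩
  · rintro _ ⟨y, -, rfl⟩
    exact hsU (closedBall_subset_closedBall (min_le_left _ _) y.2.2)
  · exact (hKc.isClosedEmbedding_subtypeVal.isClosedMap _ hW.isClosed).preimage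
      continuous_subtype_val
  · obtain ⟨O, hO, rfl⟩ := isOpen_induced_iff.1 hW.isOpen
    convert (hO.inter (isOpen_ball (x := x) (ε := ρ))).preimage
      (continuous_subtype_val (p := (· ∈ E))) using 1
    ext y
    constructor
    · rintro ⟨z, hz, hzy⟩
      rw [mem_preimage, ← hzy]
      exact ⟨hz, hWb hz⟩
    · rintro ⟨hy1, hy2⟩
      exact ⟨⟨y, y.2, ball_subset_closedBall hy2⟩, hy1, rfl⟩

/-- Under a positively cw-expansive map, the set where two distinct iterates coincide has no small
nontrivial subcontinua. -/
theorem exists_small_continua_subsingleton_of_iterate_eq {X : Type*} [MetricSpace X]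
    [CompactSpace X] {T : X → X} (hT : Continuous T) {δ : ℝ} (hδ : 0 < δ)
    (hcw : ∀ C : Set X, IsCompact C → IsConnected C → C.Nontrivial →
      ∃ n : ℕ, δ < diam (T^[n] '' C)) {i j : ℕ} (hij : i < j) :
    ∃ r > 0, ∀ C ⊆ {x | T^[i] x = T^[j] x}, IsCompact C → IsConnected C →
      (∀ x ∈ C, ∀ y ∈ C, dist x y < r) → C.Subsingleton := by
  have huc : ∀ n : ℕ, ∃ r > 0, ∀ x y, dist x y < r → dist (T^[n] x) (T^[n] y) < δ := fun n => by
    obtain ⟨r, hr, h⟩ := Metric.uniformContinuous_iff.1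
      (CompactSpace.uniformContinuous_of_continuous (hT.iterate n)) δ hδ
    exact ⟨r, hr, fun x y hxy => h hxy⟩
  choose R hR0 hR using huc
  have hne : (Finset.range j).Nonempty := ⟨i, Finset.mem_range.2 hij⟩
  refine ⟨(Finset.range j).inf' hne R, (Finset.lt_inf'_iff _).2 fun n _ => hR0 n,
    fun C hC hCc hCconn hCr => ?_⟩
  by_contra hns
  obtain ⟨n, hn⟩ := hcw C hCc hCconn (not_subsingleton_iff.1 hns)
  refine hn.not_ge (diam_le_of_forall_dist_le hδ.le ?_)
  rintro _ ⟨x, hx, rfl⟩ _ ⟨y, hy, rfl⟩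
  have hper : ∀ z ∈ C, ∀ n, T^[n + i] z = T^[n + j] z := fun z hz n => by
    rw [iterate_add_apply, iterate_add_apply, show T^[i] z = T^[j] z from hC hz]
  clear hn
  induction n using Nat.strong_induction_on with
  | _ n ih =>
    rcases lt_or_ge n j with h | h
    · exact (hR n x y ((hCr x hx y hy).trans_le
        (Finset.inf'_le _ (Finset.mem_range.2 h)))).le
    · have h1 := hper x hx (n - j)
      have h2 := hper y hy (n - j)
      rw [Nat.sub_add_cancel h] at h1 h2
      rw [← h1, ← h2]
      exact ih _ (by omega)

/-- At most `d` of the values `h k (T^[i] x)`, `i ≤ N`, vanish. -/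
def FewZerosAlongOrbit {X ι : Type*} [TopologicalSpace X] (T : X → X) (N d : ℕ)
    (h : ι → C(X, ℝ)) (x : X) : Prop :=
  ∀ S : Finset (Fin (N + 1) × ι), (∀ p ∈ S, h p.2 (T^[p.1] x) = 0) → S.card ≤ d

theorem isOpen_forall_fewZerosAlongOrbit {X ι : Type*} [MetricSpace X] [CompactSpace X]
    [Finite ι] {T : X → X} (hT : Continuous T) (N d : ℕ) {B : Set X} (hB : IsCompact B) :
    IsOpen {h : ι → C(X, ℝ) | ∀ x ∈ B, FewZerosAlongOrbit T N d h x} := by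
  rw [isOpen_iff_eventually]
  intro h hh
  refine hB.eventually_forall_of_forall_eventually fun x hx => ?_
  have hev : ∀ p : Fin (N + 1) × ι, ∀ᶠ z : (ι → C(X, ℝ)) × X in 𝓝 (h, x),
      z.1 p.2 (T^[p.1] z.2) = 0 → h p.2 (T^[p.1] x) = 0 := by
    intro p
    by_cases hp : h p.2 (T^[p.1] x) = 0
    · exact Filter.Eventually.of_forall fun _ _ => hp
    · have hTp := hT.iterate p.1
      have hc : Continuous fun z : (ι → C(X, ℝ)) × X => z.1 p.2 (T^[p.1] z.2) := by fun_prop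
      filter_upwards [hc.continuousAt.eventually_ne hp] with z hz h0 using absurd h0 hz
  filter_upwards [Filter.eventually_all.2 hev] with z hz S hS
  exact hh x hx S fun p hp => hz p (hS p hp)

theorem dense_forall_fewZerosAlongOrbit {X ι : Type*} [MetricSpace X] [CompactSpace X]
    [Finite ι] {T : X → X} (hT : Continuous T) (N : ℕ) {d : ℕ} (hdim : CovDimLE X d)
    {B : Set X} (hB : IsCompact B)
    (hinj : ∀ i j : Fin (N + 1), ∀ x ∈ B, ∀ y ∈ B, T^[i] x = T^[j] y → i = j ∧ x = y) :
    Dense {h : ι → C(X, ℝ) | ∀ x ∈ B, FewZerosAlongOrbit T N d h x} := by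
  have := Fintype.ofFinite ι
  rw [Metric.dense_iff]
  intro h ε hε
  obtain ⟨G, hG, hG0⟩ := hdim.exists_near_card_zeros_le
    (fun p : Fin (N + 1) × ι => (h p.2).comp ⟨_, hT.iterate p.1⟩) (half_pos hε)
  have : CompactSpace B := isCompact_iff_compactSpace.1 hB
  have heq : ∀ k, ∃ q : C(X, ℝ), dist q (h k) ≤ ε / 2 ∧
      ∀ i : Fin (N + 1), ∀ x ∈ B, q (T^[i] x) = G (i, k) x := by
    intro k
    let e : (Σ _ : Fin (N + 1), B) → X := fun p => T^[p.1] p.2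
    have he : Continuous e :=
      continuous_sigma fun i => (hT.iterate i).comp continuous_subtype_val
    have hei : Injective e := by
      rintro ⟨i, x⟩ ⟨j, y⟩ hxy
      obtain ⟨rfl, h⟩ := hinj i j x x.2 y y.2 hxy
      rw [Subtype.ext h]
    have hc : Continuous fun p : (Σ _ : Fin (N + 1), B) =>
        G (p.1, k) p.2 - h k (T^[p.1] p.2) :=
      continuous_sigma fun i =>
        ((G (i, k)).continuous.comp continuous_subtype_val).sub
          ((h k).continuous.comp ((hT.iterate i).comp continuous_subtype_val))
    obtain ⟨q, hq, hqe⟩ := BoundedContinuousFunction.exists_extension_norm_eq_of_isClosedEmbedding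
      (BoundedContinuousFunction.mkOfCompact ⟨_, hc⟩) (he.isClosedEmbedding hei)
    have hqn : ‖q‖ ≤ ε / 2 := by
      rw [hq, BoundedContinuousFunction.norm_le (by positivity)]
      intro p
      exact (ContinuousMap.dist_apply_le_dist (p.2 : X)).trans (hG (p.1, k))
    refine ⟨h k + q.toContinuousMap, ?_, fun i x hx => ?_⟩
    · rw [ContinuousMap.dist_le (by positivity)]
      intro x
      simpa [Real.dist_eq] using (q.norm_coe_le_norm x).trans hqn
    · have h1 : q (T^[i] x) = G (i, k) x - h k (T^[i] x) := congrFun hqe ⟨i, x, hx⟩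
      show h k (T^[i] x) + q (T^[i] x) = _
      rw [h1]; ring
  choose q hq hqe using heq
  refine ⟨q, ?_, fun x hx S hS => hG0 x S fun p hp => ?_⟩
  · exact mem_ball.2 (((dist_pi_le_iff (by positivity)).2 hq).trans_lt (half_lt_self hε))
  · rw [← hS p hp, hqe p.2 p.1 x hx]

/-- A point whose first iterates are distinct has a compact neighborhood on which the iterates of a
locally injective map are injective with pairwise disjoint images. -/
theorem exists_compact_nhd_iterates_injective {X : Type*} [TopologicalSpace X] [T2Space X]
    [LocallyCompactSpace X] {T : X → X} (hT : Continuous T)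
    (hTloc : ∀ x : X, ∃ U ∈ 𝓝 x, Set.InjOn T U) (N : ℕ) {x : X}
    (hx : ∀ i j : ℕ, i < j → j ≤ N → T^[i] x ≠ T^[j] x) :
    ∃ B ∈ 𝓝 x, IsCompact B ∧
      ∀ i j : Fin (N + 1), ∀ y ∈ B, ∀ z ∈ B, T^[i] y = T^[j] z → i = j ∧ y = z := by
  have hloc : ∀ n : ℕ, ∀ y, ∃ U ∈ 𝓝 y, Set.InjOn T^[n] U := by
    intro n
    induction n with
    | zero => exact fun y => ⟨univ, Filter.univ_mem, injective_id.injOn⟩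
    | succ n ih =>
      intro y
      obtain ⟨U, hU, hUi⟩ := ih (T y)
      obtain ⟨V, hV, hVi⟩ := hTloc y
      exact ⟨V ∩ T ⁻¹' U, Filter.inter_mem hV (hT.continuousAt hU),
        fun a ha b hb hab => hVi ha.1 hb.1 (hUi ha.2 hb.2 hab)⟩
  have hpair : ∀ p : Fin (N + 1) × Fin (N + 1), ∃ U ∈ 𝓝 x,
      ∀ y ∈ U, ∀ z ∈ U, T^[p.1] y = T^[p.2] z → p.1 = p.2 ∧ y = z := by
    rintro ⟨i, j⟩
    by_cases hij : i = j
    · subst hij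
      obtain ⟨U, hU, hUi⟩ := hloc i x
      exact ⟨U, hU, fun y hy z hz h => ⟨rfl, hUi hy hz h⟩⟩
    · have hne : T^[i] x ≠ T^[j] x := by
        rcases lt_or_gt_of_ne hij with h | h
        · exact hx i j h (by omega)
        · exact (hx j i h (by omega)).symm
      obtain ⟨U, V, hU, hV, hxU, hxV, hUV⟩ := t2_separation hne
      refine ⟨T^[i] ⁻¹' U ∩ T^[j] ⁻¹' V, Filter.inter_mem
        ((hT.iterate i).continuousAt (hU.mem_nhds hxU))
        ((hT.iterate j).continuousAt (hV.mem_nhds hxV)), fun y hy z hz h => ?_⟩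
      exact absurd h (hUV.ne_of_mem hy.1 hz.2)
  choose U hU hUi using hpair
  obtain ⟨B, hB, hBU, hBc⟩ := local_compact_nhds (Filter.iInter_mem.2 hU)
  exact ⟨B, hB, hBc, fun i j y hy z hz =>
    hUi (i, j) y (mem_iInter.1 (hBU hy) _) z (mem_iInter.1 (hBU hz) _)⟩

/-- For a locally injective, positively cw-expansive map of a space of dimension at most `d`, any
finite family of functions can be perturbed so that at most `d` zeros occur along each orbit segment
of a given length. -/
theorem exists_near_fewZerosAlongOrbit {X ι : Type*} [MetricSpace X] [CompactSpace X] [Finite ι]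
    {d : ℕ} {T : X → X} (hT : Continuous T) (hdim : CovDimLE X d)
    (hcw : ∃ δ : ℝ, 0 < δ ∧ ∀ C : Set X, IsCompact C → IsConnected C → C.Nontrivial →
      ∃ n : ℕ, δ < diam (T^[n] '' C))
    (hTloc : ∀ x : X, ∃ U ∈ 𝓝 x, Set.InjOn T U) (N : ℕ) (h₀ : ι → C(X, ℝ)) {ε : ℝ} (hε : 0 < ε) :
    ∃ h : ι → C(X, ℝ), (∀ k, dist (h k) (h₀ k) < ε) ∧ ∀ x, FewZerosAlongOrbit T N d h x := by
  have := Fintype.ofFinite ι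
  obtain ⟨δ, hδ, hcw⟩ := hcw
  set E : ℕ × ℕ → Set X := fun p => {x | T^[p.1] x = T^[p.2] x} with hE
  have hEc : ∀ p, IsClosed (E p) := fun p => isClosed_eq (hT.iterate _) (hT.iterate _)
  have hres₁ : ∀ p : ℕ × ℕ, p.1 < p.2 →
      {h : ι → C(X, ℝ) | ∀ k, ∀ x ∈ E p, h k x ≠ 0} ∈ residual (ι → C(X, ℝ)) := by
    intro p hp
    refine residual_of_dense_open ?_ ?_
    · rw [ofPred_forall]
      refine isOpen_iInter_of_finite fun k => ?_
      rw [isOpen_iff_eventually]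
      intro h hh
      refine (hEc p).isCompact.eventually_forall_of_forall_eventually fun x hx => ?_
      have hc : Continuous fun z : (ι → C(X, ℝ)) × X => z.1 k z.2 := by fun_prop
      exact hc.continuousAt.eventually_ne (hh x hx)
    · rw [Metric.dense_iff]
      intro h η hη
      obtain ⟨r, hr, hcont⟩ := exists_small_continua_subsingleton_of_iterate_eq hT hδ hcw hp
      choose g hg hg0 using fun k => exists_near_ne_zero_of_clopen_nhds (hEc p)
        (exists_clopen_nhd_of_small_continua_subsingleton (hEc p) hr hcont) (h k) (half_pos hη)
      exact ⟨g, mem_ball.2 (((dist_pi_le_iff (by positivity)).2 hg).trans_lt (half_lt_self hη)),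
        hg0⟩
  set P : Set X := {x | ∃ i j : ℕ, i < j ∧ j ≤ N ∧ T^[i] x = T^[j] x} with hP
  have hnhd : ∀ x, ∃ B : Set X, x ∈ Pᶜ → B ∈ 𝓝 x ∧ IsCompact B ∧
      ∀ i j : Fin (N + 1), ∀ y ∈ B, ∀ z ∈ B, T^[i] y = T^[j] z → i = j ∧ y = z := by
    intro x
    by_cases hx : x ∈ Pᶜ
    · obtain ⟨B, hB⟩ := exists_compact_nhd_iterates_injective hT hTloc N (x := x)
        fun i j hij hj h => hx ⟨i, j, hij, hj, h⟩
      exact ⟨B, fun _ => hB⟩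
    · exact ⟨∅, fun h => absurd h hx⟩
  choose B hB using hnhd
  obtain ⟨t, htP, htc, htB⟩ := TopologicalSpace.countable_cover_nhdsWithin
    (s := Pᶜ) (f := B) fun x hx => mem_nhdsWithin_of_mem_nhds (hB x hx).1
  have hres₂ : ∀ x ∈ t, {h : ι → C(X, ℝ) | ∀ y ∈ B x, FewZerosAlongOrbit T N d h y} ∈
      residual (ι → C(X, ℝ)) := fun x hx =>
    residual_of_dense_open (isOpen_forall_fewZerosAlongOrbit hT N d (hB x (htP hx)).2.1)
      (dense_forall_fewZerosAlongOrbit hT N hdim (hB x (htP hx)).2.1 (hB x (htP hx)).2.2)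
  have hres := Filter.inter_mem
    ((countable_bInter_mem (Set.to_countable {p : ℕ × ℕ | p.1 < p.2})).2 hres₁)
    ((countable_bInter_mem htc).2 hres₂)
  obtain ⟨h, hh, hh₁, hh₂⟩ := Metric.dense_iff.1 (dense_of_mem_residual hres) h₀ ε hε
  refine ⟨h, fun k => (dist_le_pi_dist h h₀ k).trans_lt hh, fun x => ?_⟩
  by_cases hx : x ∈ P
  · obtain ⟨i, j, hij, -, hxij⟩ := hx
    intro S hS
    rcases S.eq_empty_or_nonempty with rfl | ⟨p, hp⟩
    · simp
    · refine absurd (hS p hp) (mem_iInter₂.1 hh₁ (i, j) hij p.2 _ ?_)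
      show T^[i] (T^[p.1] x) = T^[j] (T^[p.1] x)
      rw [← iterate_add_apply, ← iterate_add_apply, add_comm i, add_comm j, iterate_add_apply,
        iterate_add_apply, hxij]
  · obtain ⟨y, hy, hxy⟩ := mem_iUnion₂.1 (htB hx)
    exact mem_iInter₂.1 hh₂ y hy x hxy

/-- Two orbit segments of length `2 * d` with at most `d` zeros each have a common zero-free
time. -/
theorem FewZerosAlongOrbit.exists_common_ne_zero {X ι : Type*} [TopologicalSpace X] {T : X → X}
    {d : ℕ} {h : ι → C(X, ℝ)} {x y : X} (hx : FewZerosAlongOrbit T (2 * d) d h x)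
    (hy : FewZerosAlongOrbit T (2 * d) d h y) :
    ∃ i ≤ 2 * d, ∀ k, h k (T^[i] x) ≠ 0 ∧ h k (T^[i] y) ≠ 0 := by
  classical
  have hcard : ∀ z, FewZerosAlongOrbit T (2 * d) d h z →
      (Finset.univ.filter fun i : Fin (2 * d + 1) => ∃ k, h k (T^[i] z) = 0).card ≤ d := by
    intro z hz
    have hex : ∀ i : {i : Fin (2 * d + 1) // ∃ k, h k (T^[i] z) = 0},
      ∃ k, h k (T^[i.1] z) = 0 := fun i => i.2
    choose k hk using hex
    let g : {i : Fin (2 * d + 1) // ∃ k, h k (T^[i] z) = 0} ↪ Fin (2 * d + 1) × ι :=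
      ⟨fun i => (i, k i), fun i j hij => Subtype.ext (congrArg Prod.fst hij)⟩
    have := hz (Finset.univ.map g) fun p hp => by
      obtain ⟨i, -, rfl⟩ := Finset.mem_map.1 hp
      exact hk i
    rwa [Finset.card_map, Finset.card_univ, Fintype.card_subtype] at this
  by_contra! hcon
  have hun : (Finset.univ : Finset (Fin (2 * d + 1))) ⊆
      (Finset.univ.filter fun i : Fin (2 * d + 1) => ∃ k, h k (T^[i] x) = 0) ∪
      Finset.univ.filter fun i : Fin (2 * d + 1) => ∃ k, h k (T^[i] y) = 0 := by
    intro i _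
    obtain ⟨k, hk⟩ := hcon i (by omega)
    simp only [Finset.mem_union, Finset.mem_filter, Finset.mem_univ, true_and]
    by_cases h0 : h k (T^[i] x) = 0
    · exact Or.inl ⟨k, h0⟩
    · exact Or.inr ⟨k, hk h0⟩
  have h1 := (Finset.card_le_card hun).trans (Finset.card_union_le _ _)
  rw [Finset.card_univ, Fintype.card_fin] at h1
  have h2 := hcard x hx
  have h3 := hcard y hy
  omega

/-- For every scale `ρ`, there is a finite family of functions whose zero sets are met at most `d`
times by each orbit segment of length `2 * d`, and such that two points at which some function of
the family is positive have distance less than `ρ`. -/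
theorem exists_fewZerosAlongOrbit_of_scale {X : Type*} [MetricSpace X] [CompactSpace X]
    {d : ℕ} {T : X → X} (hT : Continuous T) (hdim : CovDimLE X d)
    (hcw : ∃ δ : ℝ, 0 < δ ∧ ∀ C : Set X, IsCompact C → IsConnected C → C.Nontrivial →
      ∃ n : ℕ, δ < diam (T^[n] '' C))
    (hTloc : ∀ x : X, ∃ U ∈ 𝓝 x, Set.InjOn T U) (N : ℕ) {ρ : ℝ} (hρ : 0 < ρ) :
    ∃ (t : Finset X) (h : t → C(X, ℝ)), (∀ x, FewZerosAlongOrbit T N d h x) ∧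
      (∀ x, ∃ k, 0 < h k x) ∧ ∀ k x y, 0 < h k x → 0 < h k y → dist x y < ρ := by
  obtain ⟨t, ht⟩ := CompactSpace.elim_nhds_subcover (fun x : X => ball x (ρ / 4))
    fun x => ball_mem_nhds x (by positivity)
  obtain ⟨h, hh, hz⟩ := exists_near_fewZerosAlongOrbit hT hdim hcw hTloc N
    (fun k : t => (⟨fun z => 3 * ρ / 8 - dist z k, by fun_prop⟩ : C(X, ℝ)))
    (show (0 : ℝ) < ρ / 8 by positivity)
  have hnear : ∀ k z, |h k z - (3 * ρ / 8 - dist z (k : X))| < ρ / 8 := fun k z =>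
    (ContinuousMap.dist_apply_le_dist z).trans_lt (hh k)
  refine ⟨t, h, hz, fun x => ?_, fun k x y hx hy => ?_⟩
  · have hx : x ∈ ⋃ c ∈ t, ball c (ρ / 4) := ht ▸ mem_univ x
    obtain ⟨c, hc, hxc⟩ := mem_iUnion₂.1 hx
    refine ⟨⟨c, hc⟩, ?_⟩
    have h1 := (abs_lt.1 (hnear ⟨c, hc⟩ x)).1
    have h2 := mem_ball.1 hxc
    dsimp only at h1
    linarith
  · have h1 := (abs_lt.1 (hnear k x)).2
    have h2 := (abs_lt.1 (hnear k y)).2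
    linarith [dist_triangle_right x y (k : X)]

/-- Every continuous function can be perturbed to observe `T` on the pairs whose images under
`T^[2 * d]` are at distance at least `η`. -/
theorem exists_near_observing {X : Type*} [MetricSpace X] [CompactSpace X]
    {d : ℕ} {T : X → X} (hT : Continuous T) (hdim : CovDimLE X d)
    (hcw : ∃ δ : ℝ, 0 < δ ∧ ∀ C : Set X, IsCompact C → IsConnected C → C.Nontrivial →
      ∃ n : ℕ, δ < diam (T^[n] '' C))
    (hTloc : ∀ x : X, ∃ U ∈ 𝓝 x, Set.InjOn T U) {η : ℝ} (hη : 0 < η) (f : C(X, ℝ))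
    {ε : ℝ} (hε : 0 < ε) :
    ∃ g : C(X, ℝ), dist g f ≤ ε ∧ ∀ x y : X, η ≤ dist (T^[2 * d] x) (T^[2 * d] y) →
      ∃ i ≤ 2 * d, g (T^[i] x) ≠ g (T^[i] y) := by
  have huc : ∀ n : ℕ, ∃ r > 0, ∀ x y, dist x y < r → dist (T^[n] x) (T^[n] y) < η := fun n => by
    obtain ⟨r, hr, h⟩ := Metric.uniformContinuous_iff.1
      (CompactSpace.uniformContinuous_of_continuous (hT.iterate n)) η hη
    exact ⟨r, hr, fun x y hxy => h hxy⟩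
  choose R hR0 hR using huc
  obtain ⟨r, hr, hfr⟩ := Metric.uniformContinuous_iff.1
    (CompactSpace.uniformContinuous_of_continuous f.continuous) (ε / 2) (half_pos hε)
  have hne : (Finset.range (2 * d + 1)).Nonempty := ⟨0, by simp⟩
  set ρ := min r ((Finset.range (2 * d + 1)).inf' hne R) with hρdef
  have hρ : 0 < ρ := lt_min hr ((Finset.lt_inf'_iff _).2 fun n _ => hR0 n)
  obtain ⟨t, h, hz, hpos, hsmall⟩ :=
    exists_fewZerosAlongOrbit_of_scale hT hdim hcw hTloc (2 * d) hρ
  obtain ⟨τ, hτ, hτ0⟩ : ∃ τ : ℝ, (∀ p ∈ (univ : Set (X × X)), ∃ i ≤ 2 * d,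
      ∀ k, τ < |h k (T^[i] p.1)| ∧ τ < |h k (T^[i] p.2)|) ∧ 0 < τ := by
    have hev : ∀ᶠ τ : ℝ in 𝓝 0, ∀ p ∈ (univ : Set (X × X)), ∃ i ≤ 2 * d,
        ∀ k, τ < |h k (T^[i] p.1)| ∧ τ < |h k (T^[i] p.2)| := by
      refine isCompact_univ.eventually_forall_of_forall_eventually fun p _ => ?_
      obtain ⟨i, hi, hne0⟩ := (hz p.1).exists_common_ne_zero (hz p.2)
      have hTi := hT.iterate i
      have hk : ∀ k, ∀ᶠ z : ℝ × (X × X) in 𝓝 (0, p),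
          z.1 < |h k (T^[i] z.2.1)| ∧ z.1 < |h k (T^[i] z.2.2)| := fun k =>
        (continuous_fst.continuousAt.eventually_lt
          (((h k).continuous.comp (hTi.comp (continuous_fst.comp continuous_snd))).abs).continuousAt
          (abs_pos.2 (hne0 k).1)).and
        (continuous_fst.continuousAt.eventually_lt
          (((h k).continuous.comp (hTi.comp (continuous_snd.comp continuous_snd))).abs).continuousAt
          (abs_pos.2 (hne0 k).2))
      filter_upwards [Filter.eventually_all.2 hk] with z hz using ⟨i, hi, hz⟩
    exact ((hev.filter_mono nhdsWithin_le_nhds).and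
      (self_mem_nhdsWithin : Ioi (0 : ℝ) ∈ 𝓝[>] 0)).exists
  have hD : IsClosed {z | ∀ k, τ ≤ |h k z|} := by
    simp only [ofPred_forall]
    exact isClosed_iInter fun k => isClosed_le continuous_const (by fun_prop)
  obtain ⟨g, hg, -, hgsep⟩ := exists_near_separating hD (fun k => {z | 0 < h k z})
    (fun k => by
      refine ⟨⟨?_⟩, (isOpen_lt continuous_const (h k).continuous).preimage continuous_subtype_val⟩
      convert isOpen_lt (f := fun z : {z | ∀ k, τ ≤ |h k z|} => h k z)
        (g := fun _ => 0) (by fun_prop) continuous_const using 1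
      ext z
      have : h k z ≠ 0 := abs_pos.1 (hτ0.trans_le (z.2 k))
      simp [le_iff_lt_or_eq, this])
    (fun z _ => mem_iUnion.2 (hpos z)) f (half_pos hε)
    (fun k z hz w hw =>
      (hfr ((hsmall k z w hz.2 hw.2).trans_le (min_le_left _ _))).le)
  refine ⟨g, hg.trans (by linarith), fun x y hxy => ?_⟩
  obtain ⟨i, hi, hi'⟩ := hτ (x, y) (mem_univ _)
  refine ⟨i, hi, fun heq => ?_⟩
  obtain ⟨k, hk1, hk2⟩ := hgsep _ (fun k => (hi' k).1.le) _ (fun k => (hi' k).2.le) heq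
  have h1 : dist (T^[i] x) (T^[i] y) < R (2 * d - i) :=
    (hsmall k _ _ hk1 hk2).trans_le ((min_le_right _ _).trans
      (Finset.inf'_le _ (Finset.mem_range.2 (by omega))))
  have h2 := hR _ _ _ h1
  rw [← iterate_add_apply, ← iterate_add_apply, Nat.sub_add_cancel hi] at h2
  exact h2.not_ge hxy

theorem isOpen_observing {X : Type*} [MetricSpace X] [CompactSpace X] {T : X → X}
    (hT : Continuous T) (N : ℕ) (η : ℝ) :
    IsOpen {f : C(X, ℝ) | ∀ x y : X, η ≤ dist (T^[N] x) (T^[N] y) →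
      ∃ i ≤ N, f (T^[i] x) ≠ f (T^[i] y)} := by
  have hK : IsCompact {p : X × X | η ≤ dist (T^[N] p.1) (T^[N] p.2)} := by
    have := hT.iterate N
    exact (isClosed_le continuous_const (by fun_prop)).isCompact
  rw [isOpen_iff_eventually]
  intro f hf
  have hev : ∀ᶠ g : C(X, ℝ) in 𝓝 f, ∀ p ∈ {p : X × X | η ≤ dist (T^[N] p.1) (T^[N] p.2)},
      ∃ i ≤ N, g (T^[i] p.1) ≠ g (T^[i] p.2) := by
    refine hK.eventually_forall_of_forall_eventually fun p hp => ?_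
    obtain ⟨i, hi, hne⟩ := hf p.1 p.2 hp
    have hTi := hT.iterate i
    have hc₁ : Continuous fun z : C(X, ℝ) × (X × X) => z.1 (T^[i] z.2.1) := by fun_prop
    have hc₂ : Continuous fun z : C(X, ℝ) × (X × X) => z.1 (T^[i] z.2.2) := by fun_prop
    filter_upwards [(isOpen_ne_fun hc₁ hc₂).mem_nhds hne] with z hz using ⟨i, hi, hz⟩
  filter_upwards [hev] with g hg x y hxy using hg (x, y) hxy

/-- If `T` is a locally injective, positively cw-expansive continuous map of a compact
metric space `X` with `dim X ≤ d`, then a residual set of `f ∈ C(X, ℝ)` observes `T` on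
`(X × X) \ Δ_{2d}(T)` in `2d` steps. -/
theorem stmt13 {X : Type*} [MetricSpace X] [CompactSpace X] (d : ℕ)
    (T : X → X) (hTcont : Continuous T)
    (hdim : CovDimLE X d)
    (hcw : ∃ δ : ℝ, 0 < δ ∧ ∀ C : Set X, IsCompact C → IsConnected C → C.Nontrivial →
      ∃ n : ℕ, δ < diam (T^[n] '' C))
    (hTloc : ∀ x : X, ∃ U ∈ 𝓝 x, Set.InjOn T U) :
    {f : C(X, ℝ) | ∀ x y : X, T^[2 * d] x ≠ T^[2 * d] y →
        ∃ i : ℕ, i ≤ 2 * d ∧ f (T^[i] x) ≠ f (T^[i] y)} ∈ residual C(X, ℝ) := by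
  have hres : ∀ n : ℕ, {f : C(X, ℝ) | ∀ x y : X,
      1 / ((n : ℝ) + 1) ≤ dist (T^[2 * d] x) (T^[2 * d] y) →
        ∃ i ≤ 2 * d, f (T^[i] x) ≠ f (T^[i] y)} ∈ residual C(X, ℝ) := by
    intro n
    refine residual_of_dense_open (isOpen_observing hTcont _ _) ?_
    rw [Metric.dense_iff]
    intro f ε hε
    obtain ⟨g, hg, hobs⟩ := exists_near_observing hTcont hdim hcw hTloc
      (show 0 < 1 / ((n : ℝ) + 1) by positivity) f (half_pos hε)
    exact ⟨g, mem_ball.2 (hg.trans_lt (half_lt_self hε)), hobs⟩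
  filter_upwards [countable_iInter_mem.2 hres] with f hf x y hxy
  obtain ⟨n, hn⟩ := exists_nat_one_div_lt (dist_pos.2 hxy)
  exact mem_iInter.1 hf n x y hn.le
end

section
/- Let U be a compact metric space with topological dimension dim U ≤ r, and let H_1, …, H_n ⊆ ℝ^{r+s+1} be affine subspaces with dim H_i ≤ s for i = 1, …, n. Then the set Ω = { F ∈ C(U, ℝ^{r+s+1}) : F(U) ∩ H_i = ∅ for all i = 1, …, n } is open and dense in C(U, ℝ^{r+s+1}). -/
open Set Topology Function

/-- If a point `q` avoids the affine subspace spanned by `P` and the points `y j`, `j ∈ S`,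
then no affine combination of `q` and these points with nonzero weight at `q` lies in `P`. -/
lemma smul_add_sum_smul_notMem {E ι : Type*} [AddCommGroup E] [Module ℝ E]
    (P : AffineSubspace ℝ E) {p : E} (hp : p ∈ P) (y : ι → E) (S : Finset ι) (w : ι → ℝ)
    {a : ℝ} (ha : a ≠ 0) (hw : a + ∑ j ∈ S, w j = 1) {q : E}
    (hq : q ∉ AffineSubspace.mk' p
      (P.direction ⊔ Submodule.span ℝ ((fun j ↦ y j - p) '' (S : Set ι)))) :
    a • q + ∑ j ∈ S, w j • y j ∉ P := by
  intro hz
  apply hq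
  rw [AffineSubspace.mem_mk', vsub_eq_sub]
  have key : q - p = a⁻¹ • (((a • q + ∑ j ∈ S, w j • y j) - p)
      - ∑ j ∈ S, w j • (y j - p)) := by
    have h1 : ∑ j ∈ S, w j • (y j - p) = ∑ j ∈ S, w j • y j - (1 - a) • p := by
      rw [← hw]
      simp [smul_sub, Finset.sum_sub_distrib, Finset.sum_smul]
    rw [h1, eq_inv_smul_iff₀ ha]
    module
  rw [key]
  refine Submodule.smul_mem _ _ (Submodule.sub_mem _ ?_ ?_)
  · exact Submodule.mem_sup_left (P.vsub_mem_direction hz hp)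
  · refine Submodule.mem_sup_right (Submodule.sum_mem _ fun j hj ↦ Submodule.smul_mem _ _ ?_)
    exact Submodule.subset_span ⟨j, hj, rfl⟩

/-- A ball is not covered by finitely many proper affine subspaces. -/
lemma exists_dist_lt_forall_notMem_affineSubspace {E κ : Type*} [NormedAddCommGroup E]
    [NormedSpace ℝ E] [FiniteDimensional ℝ E] [Finite κ] (A : κ → AffineSubspace ℝ E)
    (hA : ∀ k, A k ≠ ⊤) (c : E) {ε : ℝ} (hε : 0 < ε) :
    ∃ q, dist q c < ε ∧ ∀ k, q ∉ A k := by
  borelize E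
  let μ : MeasureTheory.Measure E := MeasureTheory.Measure.addHaar
  have hnull : μ (⋃ k, (A k : Set E)) = 0 :=
    MeasureTheory.measure_iUnion_null fun k ↦
      MeasureTheory.Measure.addHaar_affineSubspace μ (A k) (hA k)
  by_contra! h
  have hsub : Metric.ball c ε ⊆ ⋃ k, (A k : Set E) := fun q hq ↦ by
    obtain ⟨k, hk⟩ := h q hq
    exact mem_iUnion.2 ⟨k, hk⟩
  exact (Metric.measure_ball_pos μ c hε).ne' (MeasureTheory.measure_mono_null hsub hnull)

/-- Finitely many points can be perturbed into general position with respect to finitely many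
affine subspaces of dimension at most `s`: the affine span of at most `r + 1` of them avoids all
the subspaces, provided that the ambient dimension exceeds `r + s`. -/
lemma exists_dist_lt_forall_sum_smul_notMem {E ι κ : Type*} [NormedAddCommGroup E]
    [NormedSpace ℝ E] [FiniteDimensional ℝ E] [Finite κ] {r s : ℕ}
    (hE : r + s < Module.finrank ℝ E) (H : κ → AffineSubspace ℝ E)
    (hne : ∀ i, (H i : Set E).Nonempty) (hdim : ∀ i, Module.finrank ℝ (H i).direction ≤ s)
    (c : ι → E) {ε : ℝ} (hε : 0 < ε) (J : Finset ι) :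
    ∃ y : ι → E, (∀ j ∈ J, dist (y j) (c j) < ε) ∧
      ∀ S ⊆ J, S.card ≤ r + 1 → ∀ w : ι → ℝ, ∑ j ∈ S, w j = 1 →
        ∀ i, ∑ j ∈ S, w j • y j ∉ H i := by
  classical
  choose p hp using hne
  induction J using Finset.induction_on with
  | empty =>
    refine ⟨c, by simp, fun S hS _ w hw ↦ ?_⟩
    rw [Finset.subset_empty.1 hS] at hw
    simp at hw
  | insert j₀ J hj₀ ih =>
    obtain ⟨y, hy, hgen⟩ := ih
    let A : {S : Finset ι // S ∈ J.powerset ∧ S.card ≤ r} × κ → AffineSubspace ℝ E := fun k ↦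
      AffineSubspace.mk' (p k.2) ((H k.2).direction ⊔
        Submodule.span ℝ ((fun j ↦ y j - p k.2) '' (k.1.1 : Set ι)))
    have : Finite {S : Finset ι // S ∈ J.powerset ∧ S.card ≤ r} :=
      (J.powerset.finite_toSet.subset fun S hS ↦ hS.1).to_subtype
    have hA : ∀ k, A k ≠ ⊤ := by
      rintro ⟨⟨S, hSJ, hS⟩, i⟩ htop
      have h1 : (H i).direction ⊔
          Submodule.span ℝ ((fun j ↦ y j - p i) '' (S : Set ι)) = ⊤ := by
        rw [← AffineSubspace.direction_mk' (p i) (_ ⊔ _), ← AffineSubspace.direction_top ℝ E E]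
        exact congrArg AffineSubspace.direction htop
      have h2 := Submodule.finrank_add_le_finrank_add_finrank (H i).direction
        (Submodule.span ℝ ((fun j ↦ y j - p i) '' (S : Set ι)))
      rw [h1, finrank_top] at h2
      have h3 : Module.finrank ℝ (Submodule.span ℝ ((fun j ↦ y j - p i) '' (S : Set ι)))
          ≤ S.card := by
        rw [← Finset.coe_image]
        exact (finrank_span_finset_le_card _).trans Finset.card_image_le
      have h4 := hdim i
      omega
    obtain ⟨q, hqc, hq⟩ := exists_dist_lt_forall_notMem_affineSubspace A hA (c j₀) hε
    have hupd {S : Finset ι} (hS : j₀ ∉ S) (w : ι → ℝ) :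
        ∑ j ∈ S, w j • update y j₀ q j = ∑ j ∈ S, w j • y j :=
      Finset.sum_congr rfl fun j hj ↦ by
        rw [update_of_ne (ne_of_mem_of_not_mem hj hS)]
    refine ⟨update y j₀ q, fun j hj ↦ ?_, fun S hS hcard w hw i ↦ ?_⟩
    · rcases Finset.mem_insert.1 hj with rfl | hj
      · simpa using hqc
      · rw [update_of_ne (ne_of_mem_of_not_mem hj hj₀)]
        exact hy j hj
    · by_cases hjS : j₀ ∈ S
      · have hT : S.erase j₀ ⊆ J := Finset.subset_insert_iff.1 hS
        have hTcard := Finset.card_erase_of_mem hjS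
        rw [← Finset.add_sum_erase _ _ hjS] at hw ⊢
        rw [hupd (Finset.notMem_erase _ _), update_self]
        by_cases ha : w j₀ = 0
        · rw [ha, zero_add] at hw
          rw [ha, zero_smul, zero_add]
          exact hgen _ hT (by omega) w hw i
        · exact smul_add_sum_smul_notMem (H i) (hp i) y _ w ha hw
            (hq (⟨S.erase j₀, Finset.mem_powerset.2 hT, by omega⟩, i))
      · rw [hupd hjS]
        exact hgen S ((Finset.subset_insert_iff_of_notMem hjS).1 hS) hcard w hw i

/-- In a compact space of covering dimension at most `d`, every open cover has a finite open
refinement of order at most `d + 1`. -/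
lemma CovDimLE.exists_finset {X : Type*} [TopologicalSpace X] [CompactSpace X] {d : ℕ}
    (h : CovDimLE X d) (𝒰 : Set (Set X)) (hopen : ∀ U ∈ 𝒰, IsOpen U)
    (hcover : ⋃₀ 𝒰 = Set.univ) :
    ∃ t : Finset (Set X), (∀ V ∈ t, IsOpen V) ∧ ⋃₀ (t : Set (Set X)) = Set.univ ∧
      (∀ V ∈ t, ∃ U ∈ 𝒰, V ⊆ U) ∧
      ∀ (x : X) (S : Finset (Set X)), S ⊆ t → (∀ V ∈ S, x ∈ V) → S.card ≤ d + 1 := by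
  obtain ⟨𝒱, hVo, hVc, hVr, hVx⟩ := h 𝒰 hopen hcover
  obtain ⟨T, hT𝒱, hTfin, hTc⟩ := isCompact_univ.elim_finite_subcover_image (c := id) hVo
    (by rw [← hVc, sUnion_eq_biUnion]; rfl)
  lift T to Finset (Set X) using hTfin
  replace hTc : Set.univ ⊆ ⋃₀ (T : Set (Set X)) := by rw [sUnion_eq_biUnion]; exact hTc
  refine ⟨T, fun V hV ↦ hVo V (hT𝒱 hV), univ_subset_iff.1 hTc, fun V hV ↦ hVr V (hT𝒱 hV),
    fun x S hS hx ↦ ?_⟩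
  obtain ⟨hfin, hcard⟩ := hVx x
  rw [← Set.ncard_coe_finset]
  have hsub : (S : Set (Set X)) ⊆ {V ∈ 𝒱 | x ∈ V} := fun V hV ↦ ⟨hT𝒱 (hS hV), hx V hV⟩
  exact (Set.ncard_le_ncard hsub hfin).trans hcard

/-- If `U` is a compact metric space with `dim U ≤ r` and `H₁, …, Hₙ ⊆ ℝ^{r+s+1}` are
(nonempty) affine subspaces of dimension at most `s`, then the set of `F ∈ C(U, ℝ^{r+s+1})`
whose image avoids every `Hᵢ` is open and dense. -/
theorem stmt14 {U : Type*} [MetricSpace U] [CompactSpace U]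
    (r s n : ℕ) (hU : CovDimLE U r)
    (H : Fin n → AffineSubspace ℝ (EuclideanSpace ℝ (Fin (r + s + 1))))
    (hne : ∀ i, (H i : Set (EuclideanSpace ℝ (Fin (r + s + 1)))).Nonempty)
    (hdim : ∀ i, Module.finrank ℝ (H i).direction ≤ s) :
    IsOpen {F : C(U, EuclideanSpace ℝ (Fin (r + s + 1))) | ∀ i, ∀ x : U, F x ∉ H i} ∧
    Dense {F : C(U, EuclideanSpace ℝ (Fin (r + s + 1))) | ∀ i, ∀ x : U, F x ∉ H i} := by
  constructor
  · have hclosed : ∀ i, IsClosed (H i : Set (EuclideanSpace ℝ (Fin (r + s + 1)))) :=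
      fun i ↦ (H i).closed_of_finiteDimensional
    convert ContinuousMap.isOpen_setOfPred_mapsTo (X := U) isCompact_univ
      (isOpen_iInter_of_finite fun i ↦ (hclosed i).isOpen_compl) using 1
    ext F
    simp only [mem_ofPred_eq, MapsTo, mem_univ, true_imp_iff, mem_iInter, mem_compl_iff,
      SetLike.mem_coe]
    exact forall_comm
  · refine Metric.dense_iff.2 fun F ε hε ↦ ?_
    obtain ⟨t, hto, htc, htr, htx⟩ := hU.exists_finset
      (range fun e ↦ F ⁻¹' Metric.ball e (ε / 4))
      (by rintro _ ⟨e, rfl⟩; exact Metric.isOpen_ball.preimage F.continuous)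
      (eq_univ_of_forall fun x ↦ ⟨_, ⟨F x, rfl⟩, Metric.mem_ball_self (by positivity)⟩)
    have hc : ∀ V : t, ∃ e, ∀ x ∈ V.1, dist (F x) e < ε / 4 := fun V ↦ by
      obtain ⟨_, ⟨e, rfl⟩, hV⟩ := htr V.1 V.2
      exact ⟨e, fun x hx ↦ hV hx⟩
    choose c hc using hc
    obtain ⟨y, hyc, hy⟩ := exists_dist_lt_forall_sum_smul_notMem (r := r) (s := s)
      (by simp) H hne hdim c (show 0 < ε / 4 by positivity) Finset.univ
    obtain ⟨φ, hφ⟩ := PartitionOfUnity.exists_isSubordinate isClosed_univ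
      (fun V : t ↦ V.1) (fun V ↦ hto V.1 V.2)
      (fun x _ ↦ by
        obtain ⟨V, hV, hx⟩ := htc.ge (mem_univ x)
        exact mem_iUnion.2 ⟨⟨V, hV⟩, hx⟩)
    have hsum : ∀ x, ∑ V, φ V x = 1 := fun x ↦ by
      rw [← finsum_eq_sum_of_fintype]
      exact φ.sum_eq_one (mem_univ x)
    have hzero : ∀ (V : t) x, x ∉ V.1 → φ V x = 0 := fun V x hx ↦
      image_eq_zero_of_notMem_tsupport fun h ↦ hx (hφ V h)
    let G : C(U, EuclideanSpace ℝ (Fin (r + s + 1))) :=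
      ⟨fun x ↦ ∑ V, φ V x • y V, by fun_prop⟩
    classical
    have hS : ∀ x, ∑ V with x ∈ V.1, φ V x = 1 := fun x ↦ by
      rw [← hsum x]
      exact Finset.sum_filter_of_ne fun V _ hV ↦ not_imp_comm.1 (hzero V x) hV
    have hG : ∀ x, G x = ∑ V with x ∈ V.1, φ V x • y V := fun x ↦
      (Finset.sum_filter_of_ne fun V _ hV ↦
        not_imp_comm.1 (hzero V x) (left_ne_zero_of_smul hV)).symm
    refine ⟨G, ?_, fun i x ↦ ?_⟩
    · refine ((ContinuousMap.dist_le (by positivity)).2 fun x ↦ ?_).trans_lt (half_lt_self hε)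
      suffices G x ∈ Metric.ball (F x) (ε / 2) from (Metric.mem_ball.1 this).le
      rw [hG]
      refine (convex_ball _ _).sum_mem (fun V _ ↦ φ.nonneg V x) (hS x) fun V hV ↦ ?_
      have h1 := hc V x (Finset.mem_filter.1 hV).2
      have h2 := hyc V (Finset.mem_univ _)
      have h3 := dist_triangle_right (y V) (F x) (c V)
      rw [Metric.mem_ball]
      linarith
    · rw [hG]
      refine hy _ (Finset.subset_univ _) ?_ _ (hS x) i
      rw [← Finset.card_map (Embedding.subtype _)]
      refine htx x _ (fun V hV ↦ ?_) fun V hV ↦ ?_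
      all_goals
        obtain ⟨W, hW, rfl⟩ := Finset.mem_map.1 hV
      · exact W.2
      · exact (Finset.mem_filter.1 hW).2
end

section
/- Let U and V be compact metric spaces with dim U + dim V ≤ n and let S ⊆ ℝ^{n+1} be a convex set. Then the set Ω = { (F, G) ∈ C(U, ℝ^{n+1}) × C(V, S) : F(U) ∩ G(V) = ∅ } is open and dense in C(U, ℝ^{n+1}) × C(V, S). -/
open Set Topology Function

/-- The set `Ω = {(F, G) : F(U) ∩ G(V) = ∅}` inside `C(U, ℝ^{n+1}) × C(V, S)`, where
`C(V, S)` is the subspace of maps `V → ℝ^{n+1}` with image contained in `S`. -/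
def stmt15Omega (U V : Type*) [TopologicalSpace U] [TopologicalSpace V] (n : ℕ)
    (S : Set (EuclideanSpace ℝ (Fin (n + 1)))) :
    Set (C(U, EuclideanSpace ℝ (Fin (n + 1))) ×
      {G : C(V, EuclideanSpace ℝ (Fin (n + 1))) // ∀ y : V, G y ∈ S}) :=
  {p | ∀ (x : U) (y : V), p.1 x ≠ p.2.1 y}

open MeasureTheory in
/-- Two finite sets whose cardinalities are small compared to the dimension: the differences of
points of their convex hulls form a null set. -/
theorem volume_convexHull_sub_convexHull_eq_zero {n a b : ℕ} (hab : a + b ≤ n)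
    (A B : Finset (EuclideanSpace ℝ (Fin (n + 1)))) (hA : A.card ≤ a + 1) (hB : B.card ≤ b + 1) :
    volume {t : EuclideanSpace ℝ (Fin (n + 1)) | ∃ x ∈ convexHull ℝ (A : Set _),
      ∃ y ∈ convexHull ℝ (B : Set _), x + t = y} = 0 := by
  have finrank_le : ∀ (C : Finset (EuclideanSpace ℝ (Fin (n + 1)))) (c : ℕ), C.Nonempty →
      C.card ≤ c + 1 → Module.finrank ℝ (vectorSpan ℝ (SetLike.coe C)) ≤ c := by
    classical
    intro C c hC hc
    have hpos := hC.card_pos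
    have h := finrank_vectorSpan_image_finset_le ℝ (id : EuclideanSpace ℝ (Fin (n + 1)) → _) C
      (n := C.card - 1) (by omega)
    rw [Finset.image_id] at h
    omega
  rcases A.eq_empty_or_nonempty with rfl | hA'
  · simp
  rcases B.eq_empty_or_nonempty with rfl | hB'
  · simp
  obtain ⟨p, hp⟩ := hA'
  obtain ⟨q, hq⟩ := hB'
  have hWA := finrank_le A a ⟨p, hp⟩ hA
  have hWB := finrank_le B b ⟨q, hq⟩ hB
  set W := vectorSpan ℝ (SetLike.coe A) ⊔ vectorSpan ℝ (SetLike.coe B)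
    with hW
  have hWrank : Module.finrank ℝ W ≤ n :=
    (Submodule.finrank_add_le_finrank_add_finrank _ _).trans (by omega)
  have hne : AffineSubspace.mk' (q - p) W ≠ ⊤ := by
    intro h
    have hdir := congrArg AffineSubspace.direction h
    rw [AffineSubspace.direction_mk', AffineSubspace.direction_top] at hdir
    rw [hdir, finrank_top, finrank_euclideanSpace_fin] at hWrank
    omega
  refine measure_mono_null ?_ (Measure.addHaar_affineSubspace volume _ hne)
  rintro t ⟨x, hx, y, hy, rfl⟩
  have hx' : x - p ∈ vectorSpan ℝ (SetLike.coe A) := by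
    rw [← direction_affineSpan]
    exact AffineSubspace.vsub_mem_direction (convexHull_subset_affineSpan _ hx)
      (subset_affineSpan ℝ _ hp)
  have hy' : (x + t) - q ∈ vectorSpan ℝ (SetLike.coe B) := by
    rw [← direction_affineSpan]
    exact AffineSubspace.vsub_mem_direction (convexHull_subset_affineSpan _ hy)
      (subset_affineSpan ℝ _ hq)
  rw [SetLike.mem_coe, AffineSubspace.mem_mk', vsub_eq_sub]
  have : t - (q - p) = -(x - p) + ((x + t) - q) := by abel
  rw [this]
  exact W.add_mem (W.neg_mem (Submodule.mem_sup_left hx')) (Submodule.mem_sup_right hy')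

/-- A continuous map from a compact space of covering dimension at most `d` into a convex set
can be approximated by maps into that set whose image lies in a finite union of simplices of
dimension at most `d`. -/
theorem CovDimLE.exists_approx_mem_convexHull {X E : Type*} [TopologicalSpace X] [CompactSpace X]
    [T2Space X] [NormedAddCommGroup E] [NormedSpace ℝ E] {d : ℕ} (hX : CovDimLE X d)
    {K : Set E} (hK : Convex ℝ K) (f : C(X, E)) (hf : ∀ x, f x ∈ K) {ε : ℝ} (hε : 0 < ε) :
    ∃ (g : C(X, E)) (𝒜 : Finset (Finset E)), (∀ A ∈ 𝒜, A.card ≤ d + 1) ∧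
      (∀ x, dist (g x) (f x) < ε) ∧ (∀ x, g x ∈ K) ∧
      ∀ x, ∃ A ∈ 𝒜, g x ∈ convexHull ℝ (A : Set E) := by
  classical
  obtain ⟨𝒱, h𝒱o, h𝒱c, h𝒱r, h𝒱d⟩ := hX (Set.range fun z ↦ f ⁻¹' Metric.ball (f z) ε)
    (by rintro _ ⟨z, rfl⟩; exact Metric.isOpen_ball.preimage f.continuous)
    (Set.eq_univ_of_forall fun x ↦ ⟨_, ⟨x, rfl⟩, Metric.mem_ball_self hε⟩)
  have h𝒱z : ∀ V : 𝒱, ∃ z, (V : Set X) ⊆ f ⁻¹' Metric.ball (f z) ε := by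
    intro V
    obtain ⟨_, ⟨z, rfl⟩, hz⟩ := h𝒱r V V.2
    exact ⟨z, hz⟩
  choose z hz using h𝒱z
  obtain ⟨t, ht⟩ := isCompact_univ.elim_finite_subcover (fun V : 𝒱 ↦ (V : Set X))
    (fun V ↦ h𝒱o V V.2) (by rw [← Set.sUnion_eq_iUnion, h𝒱c])
  obtain ⟨ρ, hρ⟩ := PartitionOfUnity.exists_isSubordinate_of_locallyFinite isClosed_univ
    (fun i : t ↦ ((i : 𝒱) : Set X)) (fun i ↦ h𝒱o _ i.1.2) (locallyFinite_of_finite _)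
    (fun x hx ↦ by
      obtain ⟨V, hV, hxV⟩ := Set.mem_iUnion₂.1 (ht hx)
      exact Set.mem_iUnion.2 ⟨⟨V, hV⟩, hxV⟩)
  have hmem : ∀ (i : t) (x : X), ρ i x ≠ 0 → x ∈ ((i : 𝒱) : Set X) := fun i x hx ↦
    hρ i (subset_tsupport _ hx)
  have hconv : ∀ (x : X) (C : Set E), Convex ℝ C →
      (∀ i : t, x ∈ ((i : 𝒱) : Set X) → f (z i) ∈ C) → ∑ᶠ i, ρ i x • f (z i) ∈ C :=
    fun x C hC h ↦ ρ.finsum_smul_mem_convex (g := fun i _ ↦ f (z i)) (Set.mem_univ x)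
      (fun i hi ↦ h i (hmem i x hi)) hC
  refine ⟨⟨fun x ↦ ∑ᶠ i, ρ i x • f (z i),
      ρ.continuous_finsum_smul fun i x _ ↦ continuousAt_const⟩,
    (Finset.univ.image fun T : Finset t ↦ T.image fun i : t ↦ f (z i)).filter (·.card ≤ d + 1),
    fun A hA ↦ (Finset.mem_filter.1 hA).2,
    fun x ↦ hconv x _ (convex_ball (f x) ε) fun i hi ↦ ?_,
    fun x ↦ hconv x K hK fun i _ ↦ hf _,
    fun x ↦ ⟨(Finset.univ.filter fun i : t ↦ x ∈ ((i : 𝒱) : Set X)).image fun i : t ↦ f (z i), ?_,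
      hconv x _ (convex_convexHull ℝ _) fun i hi ↦ subset_convexHull ℝ _ ?_⟩⟩
  · rw [Metric.mem_ball, dist_comm]
    exact hz i hi
  · refine Finset.mem_filter.2 ⟨Finset.mem_image_of_mem _ (Finset.mem_univ _), ?_⟩
    refine Finset.card_image_le.trans (le_trans ?_ (h𝒱d x).2)
    rw [Nat.card_coe_set_eq, ← Set.ncard_coe_finset]
    refine Set.ncard_le_ncard_of_injOn (fun i : t ↦ ((i : 𝒱) : Set X)) (fun i hi ↦ ?_)
      (fun i _ j _ h ↦ Subtype.ext (Subtype.ext h)) (h𝒱d x).1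
    exact ⟨i.1.2, by simpa using hi⟩
  · exact Finset.mem_coe.2 (Finset.mem_image_of_mem _ (by simpa using hi))

theorem isOpen_stmt15Omega (U V : Type*) [TopologicalSpace U] [CompactSpace U] [T2Space U]
    [TopologicalSpace V] [CompactSpace V] [T2Space V] (n : ℕ)
    (S : Set (EuclideanSpace ℝ (Fin (n + 1)))) : IsOpen (stmt15Omega U V n S) := by
  let Z : Set ((C(U, EuclideanSpace ℝ (Fin (n + 1))) ×
      {G : C(V, EuclideanSpace ℝ (Fin (n + 1))) // ∀ y : V, G y ∈ S}) × (U × V)) :=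
    {w | w.1.1 w.2.1 = w.1.2.1 w.2.2}
  have hZ : IsClosed Z := by
    refine isClosed_eq ?_ ?_
    · exact ContinuousEval.continuous_eval.comp
        ((continuous_fst.comp continuous_fst).prodMk (continuous_fst.comp continuous_snd))
    · exact ContinuousEval.continuous_eval.comp
        ((continuous_subtype_val.comp (continuous_snd.comp continuous_fst)).prodMk
          (continuous_snd.comp continuous_snd))
  convert (isClosedMap_fst_of_compactSpace _ hZ).isOpen_compl using 1
  ext p
  simp [stmt15Omega, Z]

open MeasureTheory in
theorem dense_stmt15Omega {U V : Type*} [TopologicalSpace U] [CompactSpace U] [T2Space U]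
    [TopologicalSpace V] [CompactSpace V] [T2Space V] {n a b : ℕ} (hab : a + b ≤ n)
    (hU : CovDimLE U a) (hV : CovDimLE V b)
    {S : Set (EuclideanSpace ℝ (Fin (n + 1)))} (hS : Convex ℝ S) :
    Dense (stmt15Omega U V n S) := by
  rw [Metric.dense_iff]
  rintro ⟨F, G, hG⟩ ε hε
  obtain ⟨F', 𝒜, h𝒜, hF', -, hF𝒜⟩ :=
    hU.exists_approx_mem_convexHull convex_univ F (fun _ ↦ Set.mem_univ _) (half_pos hε)
  obtain ⟨G', ℬ, hℬ, hG', hG'S, hGℬ⟩ := hV.exists_approx_mem_convexHull hS G hG hε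
  let N : Set (EuclideanSpace ℝ (Fin (n + 1))) := ⋃ A ∈ 𝒜, ⋃ B ∈ ℬ,
    {t | ∃ x ∈ convexHull ℝ (A : Set _), ∃ y ∈ convexHull ℝ (B : Set _), x + t = y}
  have hN : volume N = 0 := by
    refine (measure_biUnion_null_iff 𝒜.countable_toSet).2 fun A hA ↦ ?_
    refine (measure_biUnion_null_iff ℬ.countable_toSet).2 fun B hB ↦ ?_
    exact volume_convexHull_sub_convexHull_eq_zero hab A B (h𝒜 A hA) (hℬ B hB)
  obtain ⟨t, ht, htN⟩ : ∃ t ∈ Metric.ball (0 : EuclideanSpace ℝ (Fin (n + 1))) (ε / 2),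
      t ∉ N := by
    by_contra! h
    exact (Metric.measure_ball_pos volume 0 (half_pos hε)).ne' (measure_mono_null h hN)
  refine ⟨(F' + ContinuousMap.const U t, ⟨G', hG'S⟩), ?_, ?_⟩
  · rw [Metric.mem_ball, Prod.dist_eq, max_lt_iff]
    refine ⟨(ContinuousMap.dist_lt_iff hε).2 fun x ↦ ?_, (ContinuousMap.dist_lt_iff hε).2 hG'⟩
    rw [mem_ball_zero_iff] at ht
    calc dist (F' x + t) (F x) ≤ dist (F' x + t) (F' x) + dist (F' x) (F x) := dist_triangle _ _ _
      _ < ε / 2 + ε / 2 := add_lt_add (by simpa using ht) (hF' x)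
      _ = ε := add_halves ε
  · intro x y hxy
    obtain ⟨A, hA, hxA⟩ := hF𝒜 x
    obtain ⟨B, hB, hyB⟩ := hGℬ y
    exact htN (Set.mem_iUnion₂.2 ⟨A, hA, Set.mem_iUnion₂.2 ⟨B, hB, _, hxA, _, hyB, hxy⟩⟩)

/-- If `U, V` are compact metric spaces with `dim U + dim V ≤ n` and `S ⊆ ℝ^{n+1}` is
convex, then the set of pairs `(F, G) ∈ C(U, ℝ^{n+1}) × C(V, S)` with
`F(U) ∩ G(V) = ∅` is open and dense. -/
theorem stmt15 {U V : Type*} [MetricSpace U] [CompactSpace U]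
    [MetricSpace V] [CompactSpace V] (n : ℕ)
    (hdim : ∃ a b : ℕ, a + b ≤ n ∧ CovDimLE U a ∧ CovDimLE V b)
    (S : Set (EuclideanSpace ℝ (Fin (n + 1)))) (hS : Convex ℝ S) :
    IsOpen (stmt15Omega U V n S) ∧ Dense (stmt15Omega U V n S) := by
  obtain ⟨a, b, hab, hU, hV⟩ := hdim
  exact ⟨isOpen_stmt15Omega U V n S, dense_stmt15Omega hab hU hV hS⟩
end

section
/- Let X be a compact metric space, T : X → X a continuous map, and U, V ⊆ X compact subsets with dim U ≤ n/2 and dim V ≤ n/2, such that the sets U, TU, …, T^n U, V, TV, …, T^n V are pairwise disjoint and T is injective on each of the sets U, …, T^{n−1}U, V, …, T^{n−1}V. Then the set Ω = { f ∈ C(X, ℝ) : f observes T on U × V in n steps } is open and dense in C(X, ℝ). -/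
open Set Topology Function

open Filter Matrix in
theorem eventually_det_add_smul_ne_zero {m : ℕ} (A B : Matrix (Fin m) (Fin m) ℝ)
    (hA : A.det ≠ 0) : ∀ᶠ s : ℝ in atTop, (A + s • B).det ≠ 0 := by
  set P := ((Polynomial.X : Polynomial ℝ) • B.map Polynomial.C + A.map Polynomial.C).det with hP
  have hP0 : P ≠ 0 := by
    intro h
    apply hA
    rw [← Polynomial.coeff_det_X_add_C_zero B A, ← hP, h, Polynomial.coeff_zero]
  have heval (s : ℝ) : P.eval s = (A + s • B).det := by
    rw [hP, ← Polynomial.coe_evalRingHom, RingHom.map_det]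
    congr 1
    ext i j
    simp
    ring
  obtain ⟨M, hM⟩ := (P.roots.toFinset.finite_toSet).bddAbove
  filter_upwards [eventually_gt_atTop M] with s hs h
  refine hs.not_ge (hM ?_)
  simp [hP0, heval, h]

/-- Every finite family of points of `ℝ^N` can be moved by an arbitrarily small amount so that any
`N + 1` of its points become affinely independent. -/
theorem exists_general_position {ι : Type*} [Fintype ι] {N : ℕ} (x : ι → Fin N → ℝ) {ε : ℝ}
    (hε : 0 < ε) :
    ∃ p : ι → Fin N → ℝ, (∀ i, dist (p i) (x i) < ε) ∧
      ∀ (S : Finset ι) (w : ι → ℝ), S.card ≤ N + 1 → (∀ i ∉ S, w i = 0) →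
        ∑ i, w i = 0 → ∑ i, w i • p i = 0 → w = 0 := by
  classical
  let σ : ι → ℝ := fun i => (Fintype.equivFin ι i : ℕ)
  have hσ : Function.Injective σ := fun i j h => by
    simpa [σ, Fin.val_inj] using h
  let p : ℝ → ι → Fin N → ℝ := fun s i => x i + s⁻¹ • fun j : Fin N => σ i ^ ((j : ℕ) + 1)
  have hclose : ∀ᶠ s : ℝ in Filter.atTop, ∀ i, dist (p s i) (x i) < ε := by
    rw [Filter.eventually_all]
    intro i
    have h : Filter.Tendsto (fun s => p s i) Filter.atTop (𝓝 (x i)) := by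
      have := (tendsto_inv_atTop_zero (𝕜 := ℝ)).smul_const (fun j : Fin N => σ i ^ ((j : ℕ) + 1))
      simpa [p] using this.const_add (x i)
    exact h.eventually (Metric.ball_mem_nhds _ hε)
  have hgen : ∀ᶠ s : ℝ in Filter.atTop, ∀ S : Finset ι, S.card ≤ N + 1 →
      ∀ w : ι → ℝ, (∀ i ∉ S, w i = 0) → ∑ i, w i = 0 → ∑ i, w i • p s i = 0 → w = 0 := by
    rw [Filter.eventually_all]
    intro S
    let e := S.equivFin.symm
    let A : Matrix (Fin S.card) (Fin S.card) ℝ := Matrix.vandermonde fun k => σ (e k)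
    let B : Matrix (Fin S.card) (Fin S.card) ℝ := Matrix.of fun k j =>
      if h : 0 < (j : ℕ) ∧ (j : ℕ) - 1 < N then x (e k) ⟨(j : ℕ) - 1, h.2⟩ else 0
    have hA : A.det ≠ 0 := Matrix.det_vandermonde_ne_zero_iff.2
      (hσ.comp (Subtype.val_injective.comp e.injective))
    filter_upwards [eventually_det_add_smul_ne_zero A B hA, Filter.eventually_gt_atTop 0]
      with s hs hs0 hS w hw hw0 hwp
    have hsum (g : ι → ℝ) : ∑ k, w (e k) * g (e k) = ∑ i, w i * g i := by
      rw [Equiv.sum_comp e fun i : S => w i * g i, Finset.sum_coe_sort S fun i => w i * g i]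
      exact Finset.sum_subset (Finset.subset_univ S) fun i _ hi => by simp [hw i hi]
    have hv : (fun k => w (e k)) = 0 := by
      refine Matrix.eq_zero_of_vecMul_eq_zero hs (funext fun j => ?_)
      simp only [Matrix.vecMul, dotProduct, Matrix.add_apply, Matrix.smul_apply, A, B, Matrix.of_apply,
        Matrix.vandermonde_apply, Pi.zero_apply, smul_eq_mul]
      obtain ⟨j, hj⟩ := j
      cases j with
      | zero =>
        have := hsum fun _ => 1
        simpa [hw0] using this
      | succ j =>
        have hjN : j < N := by omega
        have := congrFun hwp ⟨j, hjN⟩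
        simp only [Finset.sum_apply, Pi.smul_apply, smul_eq_mul, Pi.zero_apply] at this
        have h2 := hsum fun i => s * p s i ⟨j, hjN⟩
        have h3 : ∑ i, w i * (s * p s i ⟨j, hjN⟩) = 0 := by
          rw [← mul_zero s, ← this, Finset.mul_sum]
          exact Finset.sum_congr rfl fun i _ => by ring
        rw [h3] at h2
        rw [← h2]
        refine Finset.sum_congr rfl fun k _ => ?_
        congr 1
        simp [p, hjN]
        field_simp
        ring
    funext i
    by_cases hi : i ∈ S
    · simpa [e] using congrFun hv (e.symm ⟨i, hi⟩)
    · exact hw i hi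
  obtain ⟨s, h1, h2⟩ := (hclose.and hgen).exists
  exact ⟨p s, h1, fun S w hS => h2 S hS w⟩

/-- A continuous map from a compact Hausdorff space of covering dimension at most `d` to a
pseudometric space admits approximate nerves: finitely many points and a subordinate partition
of unity of order at most `d + 1`. -/
theorem CovDimLE.exists_partition {K : Type*} [TopologicalSpace K] [CompactSpace K] [T2Space K]
    {d : ℕ} (hd : CovDimLE K d) {E : Type*} [PseudoMetricSpace E] (g : K → E)
    (hg : Continuous g) {ε : ℝ} (hε : 0 < ε) :
    ∃ (t : Finset (Set K)) (x : t → E) (φ : t → C(K, ℝ)),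
      (∀ i k, 0 ≤ φ i k) ∧ (∀ k, ∑ i, φ i k = 1) ∧
      (∀ k, ∃ S : Finset t, S.card ≤ d + 1 ∧ ∀ i ∉ S, φ i k = 0) ∧
      ∀ i k, φ i k ≠ 0 → dist (x i) (g k) < ε := by
  classical
  obtain ⟨𝒱, hVo, hVc, hVr, hVord⟩ := hd (Set.range fun c : E => g ⁻¹' Metric.ball c ε)
    (by rintro _ ⟨c, rfl⟩; exact Metric.isOpen_ball.preimage hg)
    (Set.eq_univ_of_forall fun k => ⟨_, ⟨g k, rfl⟩, Metric.mem_ball_self hε⟩)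
  obtain ⟨t₀, ht₀, htfin, htc⟩ := isCompact_univ.elim_finite_subcover_image (c := id) hVo
    (by rw [← hVc, Set.sUnion_eq_biUnion]; rfl)
  lift t₀ to Finset (Set K) using htfin with t
  obtain ⟨φ, hφ⟩ := PartitionOfUnity.exists_isSubordinate (isClosed_univ (X := K))
    (fun i : t => (i : Set K)) (fun i => hVo _ (ht₀ i.2))
    (fun k hk => by
      obtain ⟨V, hV, hkV⟩ := Set.mem_iUnion₂.1 (htc hk)
      exact Set.mem_iUnion.2 ⟨⟨V, hV⟩, hkV⟩)
  have hmem (i : t) (k : K) (h : φ i k ≠ 0) : k ∈ (i : Set K) :=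
    hφ i (subset_tsupport _ h)
  have hx (i : t) : ∃ c : E, (i : Set K) ⊆ g ⁻¹' Metric.ball c ε := by
    obtain ⟨_, ⟨c, rfl⟩, hc⟩ := hVr i (ht₀ i.2)
    exact ⟨c, hc⟩
  choose x hx using hx
  refine ⟨t, x, fun i => φ i, fun i k => φ.nonneg i k, fun k => ?_, fun k => ?_, fun i k h => ?_⟩
  · rw [← finsum_eq_sum_of_fintype]
    exact φ.sum_eq_one (Set.mem_univ k)
  · refine ⟨Finset.univ.filter fun i => φ i k ≠ 0, ?_, fun i hi => by simpa using hi⟩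
    obtain ⟨hfin, hcard⟩ := hVord k
    refine le_trans ?_ hcard
    rw [Nat.card_coe_set_eq, ← Finset.card_image_of_injective _ Subtype.val_injective,
      ← Set.ncard_coe_finset]
    refine Set.ncard_le_ncard ?_ hfin
    intro V hV
    simp only [Finset.coe_image, Set.mem_image, Finset.mem_coe, Finset.mem_filter] at hV
    obtain ⟨i, ⟨-, hi⟩, rfl⟩ := hV
    exact ⟨ht₀ i.2, hmem i k hi⟩
  · rw [dist_comm]
    exact hx i (hmem i k h)

theorem norm_sum_smul_sub_le {ι E : Type*} [Fintype ι] [SeminormedAddCommGroup E]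
    [NormedSpace ℝ E] {w : ι → ℝ} (hw : ∀ i, 0 ≤ w i) (hw1 : ∑ i, w i = 1) {p : ι → E} {y : E}
    {ε : ℝ} (h : ∀ i, w i ≠ 0 → dist (p i) y ≤ ε) : ‖∑ i, w i • p i - y‖ ≤ ε := by
  have : ∑ i, w i • p i - y = ∑ i, w i • (p i - y) := by
    simp_rw [smul_sub, Finset.sum_sub_distrib, ← Finset.sum_smul, hw1, one_smul]
  rw [this]
  calc ‖∑ i, w i • (p i - y)‖ ≤ ∑ i, w i * ε := norm_sum_le_of_le _ fun i _ => by
        rw [norm_smul, Real.norm_of_nonneg (hw i), ← dist_eq_norm]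
        by_cases h0 : w i = 0
        · simp [h0]
        · exact mul_le_mul_of_nonneg_left (h i h0) (hw i)
    _ = ε := by rw [← Finset.sum_mul, hw1, one_mul]

/-- Two maps to `ℝ^N` from compact spaces whose dimensions add up to less than `N` can be
approximated by maps with disjoint images. -/
theorem exists_approx_disjoint {K L : Type*} [TopologicalSpace K] [CompactSpace K] [T2Space K]
    [TopologicalSpace L] [CompactSpace L] [T2Space L] {a b N : ℕ} (hK : CovDimLE K a)
    (hL : CovDimLE L b) (hab : a + b < N) (g : C(K, Fin N → ℝ)) (h : C(L, Fin N → ℝ)) {ε : ℝ}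
    (hε : 0 < ε) :
    ∃ (F : C(K, Fin N → ℝ)) (G : C(L, Fin N → ℝ)),
      (∀ k, ‖F k - g k‖ ≤ ε) ∧ (∀ l, ‖G l - h l‖ ≤ ε) ∧ ∀ k l, F k ≠ G l := by
  classical
  obtain ⟨t, x, φ, hφ0, hφ1, hφc, hφx⟩ := hK.exists_partition g g.continuous (half_pos hε)
  obtain ⟨u, y, ψ, hψ0, hψ1, hψc, hψy⟩ := hL.exists_partition h h.continuous (half_pos hε)
  obtain ⟨p, hpx, hp⟩ := exists_general_position (Sum.elim x y) (half_pos hε)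
  refine ⟨⟨fun k => ∑ i, φ i k • p (.inl i), by fun_prop⟩,
    ⟨fun l => ∑ j, ψ j l • p (.inr j), by fun_prop⟩, fun k => ?_, fun l => ?_, fun k l hkl => ?_⟩
  · refine norm_sum_smul_sub_le (fun i => hφ0 i k) (hφ1 k) fun i hi => ?_
    have h1 := hpx (.inl i)
    have h2 := hφx i k hi
    rw [Sum.elim_inl] at h1
    linarith [dist_triangle (p (.inl i)) (x i) (g k)]
  · refine norm_sum_smul_sub_le (fun j => hψ0 j l) (hψ1 l) fun j hj => ?_
    have h1 := hpx (.inr j)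
    have h2 := hψy j l hj
    rw [Sum.elim_inr] at h1
    linarith [dist_triangle (p (.inr j)) (y j) (h l)]
  · obtain ⟨S, hS, hSφ⟩ := hφc k
    obtain ⟨R, hR, hRψ⟩ := hψc l
    have hw := hp (S.disjSum R) (Sum.elim (fun i => φ i k) fun j => -ψ j l)
      (by rw [Finset.card_disjSum]; omega)
      (by rintro (i | j) hij <;> simp at hij <;> simp [hSφ, hRψ, hij])
      (by
        rw [Fintype.sum_sum_type]
        simp only [Sum.elim_inl, Sum.elim_inr, Finset.sum_neg_distrib, hφ1, hψ1, add_neg_cancel])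
      (by
        rw [Fintype.sum_sum_type]
        simpa [sub_eq_zero, ← sub_eq_add_neg] using hkl)
    have : ∑ i, φ i k = 0 := Finset.sum_eq_zero fun i _ => congrFun hw (.inl i)
    rw [hφ1] at this
    exact one_ne_zero this

theorem isOpen_setOf_observes {X : Type*} [TopologicalSpace X] [CompactSpace X]
    {T : X → X} (hT : Continuous T) (n : ℕ) {W : Set (X × X)} (hW : IsCompact W) :
    IsOpen {f : C(X, ℝ) | ∀ z ∈ W, ∃ i : ℕ, i ≤ n ∧ f (T^[i] z.1) ≠ f (T^[i] z.2)} := by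
  rw [isOpen_iff_mem_nhds]
  intro f hf
  refine hW.eventually_forall_of_forall_eventually
    (P := fun (f : C(X, ℝ)) z => ∃ i : ℕ, i ≤ n ∧ f (T^[i] z.1) ≠ f (T^[i] z.2)) fun z hz => ?_
  obtain ⟨i, hi, hne⟩ := hf z hz
  have h1 : Continuous fun q : C(X, ℝ) × (X × X) => q.1 (T^[i] q.2.1) :=
    continuous_fst.eval ((hT.iterate i).comp (continuous_fst.comp continuous_snd))
  have h2 : Continuous fun q : C(X, ℝ) × (X × X) => q.1 (T^[i] q.2.2) :=
    continuous_fst.eval ((hT.iterate i).comp (continuous_snd.comp continuous_snd))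
  filter_upwards [(isOpen_ne_fun h1 h2).mem_nhds hne] with q hq
  exact ⟨i, hi, hq⟩

theorem injOn_iterate_of_forall_lt {X : Type*} {T : X → X} {U : Set X} {n : ℕ}
    (h : ∀ i < n, Set.InjOn T (T^[i] '' U)) : ∀ i ≤ n, Set.InjOn T^[i] U
  | 0, _ => Set.injOn_id U
  | i + 1, hi => by
    rw [Function.iterate_succ']
    exact (h i hi).comp (injOn_iterate_of_forall_lt h i (by omega)) (Set.mapsTo_image _ _)

/-- The map `(k, i) ↦ T^i k` is injective on `U × {0, …, n}`. -/
theorem injective_iterate_prod {X : Type*} {T : X → X} {U : Set X} {n : ℕ}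
    (hU : ∀ i j : ℕ, i ≤ n → j ≤ n → i ≠ j → Disjoint (T^[i] '' U) (T^[j] '' U))
    (hinj : ∀ i < n, Set.InjOn T (T^[i] '' U)) :
    Function.Injective fun q : U × Fin (n + 1) => T^[q.2] q.1 := by
  rintro ⟨x, i⟩ ⟨y, j⟩ hxy
  have hij : (i : ℕ) = j := by
    by_contra hne
    refine Set.disjoint_left.1 (hU i j (by omega) (by omega) hne) ⟨x, x.2, rfl⟩ ?_
    exact ⟨y, y.2, hxy.symm⟩
  obtain rfl := Fin.ext hij
  have := injOn_iterate_of_forall_lt hinj i (by omega) x.2 y.2 hxy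
  rw [Subtype.ext this]

/-- If `U, V ⊆ X` are compact with `dim U ≤ n/2`, `dim V ≤ n/2`, the sets
`U, …, TⁿU, V, …, TⁿV` pairwise disjoint, and `T` injective on
`U, …, T^{n-1}U, V, …, T^{n-1}V`, then the set of `f ∈ C(X, ℝ)` observing `T` on `U × V`
in `n` steps is open and dense. -/
theorem stmt16 {X : Type*} [MetricSpace X] [CompactSpace X]
    (T : X → X) (hTcont : Continuous T) (n : ℕ)
    (U V : Set X) (hUc : IsCompact U) (hVc : IsCompact V)
    (hdU : ∃ a : ℕ, 2 * a ≤ n ∧ CovDimLE U a)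
    (hdV : ∃ b : ℕ, 2 * b ≤ n ∧ CovDimLE V b)
    (hUU : ∀ i j : ℕ, i ≤ n → j ≤ n → i ≠ j → Disjoint (T^[i] '' U) (T^[j] '' U))
    (hVV : ∀ i j : ℕ, i ≤ n → j ≤ n → i ≠ j → Disjoint (T^[i] '' V) (T^[j] '' V))
    (hUV : ∀ i j : ℕ, i ≤ n → j ≤ n → Disjoint (T^[i] '' U) (T^[j] '' V))
    (hinjU : ∀ i : ℕ, i < n → Set.InjOn T (T^[i] '' U))
    (hinjV : ∀ i : ℕ, i < n → Set.InjOn T (T^[i] '' V)) :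
    IsOpen {f : C(X, ℝ) | ∀ x ∈ U, ∀ y ∈ V,
        ∃ i : ℕ, i ≤ n ∧ f (T^[i] x) ≠ f (T^[i] y)} ∧
    Dense {f : C(X, ℝ) | ∀ x ∈ U, ∀ y ∈ V,
        ∃ i : ℕ, i ≤ n ∧ f (T^[i] x) ≠ f (T^[i] y)} := by
  obtain ⟨a, ha, hdU⟩ := hdU
  obtain ⟨b, hb, hdV⟩ := hdV
  have := isCompact_iff_compactSpace.1 hUc
  have := isCompact_iff_compactSpace.1 hVc
  refine ⟨?_, ?_⟩
  · convert isOpen_setOf_observes hTcont n (hUc.prod hVc) using 4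
    exact ⟨fun h z hz => h z.1 hz.1 z.2 hz.2, fun h x hx y hy => h (x, y) ⟨hx, hy⟩⟩
  rw [Metric.dense_iff]
  intro f r hr
  let orbit (W : Set X) : C(W, Fin (n + 1) → ℝ) :=
    ⟨fun k i => f (T^[i] k), continuous_pi fun i =>
      f.continuous.comp ((hTcont.iterate i).comp continuous_subtype_val)⟩
  obtain ⟨F, G, hF, hG, hFG⟩ := exists_approx_disjoint hdU hdV (by omega : a + b < n + 1)
    (orbit U) (orbit V) (half_pos hr)
  let e : (U × Fin (n + 1)) ⊕ (V × Fin (n + 1)) → X :=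
    Sum.elim (fun q => T^[q.2] q.1) fun q => T^[q.2] q.1
  have hiter (W : Set X) : Continuous fun q : W × Fin (n + 1) => T^[q.2] q.1 :=
    continuous_prod_of_discrete_right.2 fun i => (hTcont.iterate i).comp continuous_subtype_val
  have he : IsClosedEmbedding e := by
    refine Continuous.isClosedEmbedding ((hiter U).sumElim (hiter V)) ?_
    refine (injective_iterate_prod hUU hinjU).sumElim (injective_iterate_prod hVV hinjV) ?_
    rintro ⟨x, i⟩ ⟨y, j⟩ hxy
    exact Set.disjoint_left.1 (hUV i j (by omega) (by omega)) ⟨x, x.2, rfl⟩ ⟨y, y.2, hxy.symm⟩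
  have hcoord {W : Set X} (H : C(W, Fin (n + 1) → ℝ)) :
      Continuous fun q : W × Fin (n + 1) => H q.1 q.2 :=
    continuous_prod_of_discrete_right.2 fun i => (continuous_apply i).comp H.continuous
  let Δ : C((U × Fin (n + 1)) ⊕ (V × Fin (n + 1)), ℝ) :=
    ⟨Sum.elim (fun q => (F - orbit U) q.1 q.2) fun q => (G - orbit V) q.1 q.2,
      (hcoord _).sumElim (hcoord _)⟩
  obtain ⟨D, hDnorm, hD⟩ :=
    (BoundedContinuousFunction.mkOfCompact Δ).exists_extension_norm_eq_of_isClosedEmbedding he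
  have hΔ : ‖BoundedContinuousFunction.mkOfCompact Δ‖ ≤ r / 2 := by
    refine (BoundedContinuousFunction.norm_le (half_pos hr).le).2 ?_
    rintro (⟨k, i⟩ | ⟨l, i⟩)
    · exact (norm_le_pi_norm ((F - orbit U) k) i).trans (hF k)
    · exact (norm_le_pi_norm ((G - orbit V) l) i).trans (hG l)
  have hDU (k : U) (i : Fin (n + 1)) : f (T^[i] k) + D (T^[i] k) = F k i := by
    have : D (T^[i] k) = F k i - f (T^[i] k) := congrFun hD (.inl (k, i))
    rw [this, add_sub_cancel]
  have hDV (l : V) (i : Fin (n + 1)) : f (T^[i] l) + D (T^[i] l) = G l i := by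
    have : D (T^[i] l) = G l i - f (T^[i] l) := congrFun hD (.inr (l, i))
    rw [this, add_sub_cancel]
  refine ⟨f + D.toContinuousMap, ?_, fun x hx y hy => ?_⟩
  · rw [Metric.mem_ball, ContinuousMap.dist_lt_iff hr]
    intro z
    have := (D.norm_coe_le_norm z).trans (hDnorm.le.trans hΔ)
    simpa [dist_eq_norm] using this.trans_lt (half_lt_self hr)
  · obtain ⟨i, hi⟩ := Function.ne_iff.1 (hFG ⟨x, hx⟩ ⟨y, hy⟩)
    rw [← hDU, ← hDV] at hi
    exact ⟨i, by omega, hi⟩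
end

section
/- Let X be a compact metric space, T : X → X a continuous map, and U, V ⊆ X compact subsets with dim U ≤ n, such that T^{l+k} U = T^l V and the sets U, TU, …, T^{l+k−1}U, V, TV, …, T^n V are pairwise disjoint, where 0 ≤ l < l + k ≤ n, and T is injective on each of the sets U, …, T^{l+k−1}U, V, …, T^{n−1}V. Then the set Ω = { f ∈ C(X, ℝ) : f observes T on (U × V) ∩ G_{k,l} in n steps } is open and dense in C(X, ℝ). -/
open Set Topology Function

/-- `Gk T k = {(x, T^k x) : x, Tx, …, T^k x pairwise distinct}`. -/
def Gk {X : Type*} (T : X → X) (k : ℕ) : Set (X × X) :=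
  {p | p.2 = T^[k] p.1 ∧
    ∀ i j : ℕ, i ≤ k → j ≤ k → i ≠ j → T^[i] p.1 ≠ T^[j] p.1}

/-- `Gkl T k l = {p : T^l p ∈ G_k and T^{l-1} p ∉ G_k}` (with `G_{k,0} = G_k`), where
`T` acts diagonally on pairs. -/
def Gkl {X : Type*} (T : X → X) (k l : ℕ) : Set (X × X) :=
  if l = 0 then Gk T k
  else {p | (Prod.map T T)^[l] p ∈ Gk T k ∧ (Prod.map T T)^[l - 1] p ∉ Gk T k}

/-- Finitely many points of a finite-dimensional space can be moved by less than `δ` so that any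
`finrank ℝ E` of them become linearly independent. -/
theorem exists_dist_lt_linearIndepOn {E ι : Type*} [NormedAddCommGroup E] [NormedSpace ℝ E]
    [FiniteDimensional ℝ E] (b : ι → E) {δ : ℝ} (hδ : 0 < δ) (S : Finset ι) :
    ∃ a : ι → E, (∀ i, dist (a i) (b i) < δ) ∧
      ∀ t ⊆ S, t.card ≤ Module.finrank ℝ E → LinearIndepOn ℝ a (t : Set ι) := by
  classical
  induction S using Finset.induction_on with
  | empty =>
    refine ⟨b, fun i => by simpa using hδ, fun t ht _ => ?_⟩
    rw [Finset.subset_empty.1 ht, Finset.coe_empty]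
    exact linearIndepOn_empty ℝ b
  | insert j S hj ih =>
    obtain ⟨a, hab, ha⟩ := ih
    let bad : Set E := ⋃ t ∈ S.powerset.filter fun t => t.card < Module.finrank ℝ E,
      (Submodule.span ℝ (a '' (t : Set ι)) : Set E)
    let _ : MeasurableSpace E := borel E
    have : BorelSpace E := ⟨rfl⟩
    have hbad : MeasureTheory.Measure.addHaar bad = 0 := by
      refine (MeasureTheory.measure_biUnion_null_iff (Finset.countable_toSet _)).2 fun t ht => ?_
      refine MeasureTheory.Measure.addHaar_submodule _ _ fun htop => ?_
      have hcard := finrank_span_finset_le_card (R := ℝ) (t.image a)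
      rw [Finset.coe_image, Set.finrank, htop, finrank_top] at hcard
      have := (Finset.mem_filter.1 ht).2
      have := Finset.card_image_le (s := t) (f := a)
      omega
    obtain ⟨c, hc, hcb⟩ : ∃ c ∉ bad, dist c (b j) < δ := by
      by_contra! h
      refine (Metric.measure_ball_pos MeasureTheory.Measure.addHaar (b j) hδ).ne'
        (MeasureTheory.measure_mono_null (fun c hc => ?_) hbad)
      by_contra hcbad
      exact (h c hcbad).not_gt hc
    have hupd : ∀ t ⊆ S, EqOn a (update a j c) (t : Set ι) := fun t ht i hi =>
      (update_of_ne (fun h : i = j => hj (h ▸ ht hi)) c a).symm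
    refine ⟨update a j c, fun i => ?_, fun t ht hcard => ?_⟩
    · rcases eq_or_ne i j with rfl | hij
      · simpa using hcb
      · simpa [hij] using hab i
    · by_cases hjt : j ∈ t
      · have hsub : t.erase j ⊆ S := by
          rwa [Finset.subset_insert_iff] at ht
        have hlt : (t.erase j).card < Module.finrank ℝ E :=
          (Finset.card_erase_lt_of_mem hjt).trans_le hcard
        rw [← Finset.insert_erase hjt, Finset.coe_insert]
        refine ((ha _ hsub hlt.le).congr (hupd _ hsub)).insert ?_
        rw [update_self, ← (hupd _ hsub).image_eq]
        exact fun hmem => hc (mem_biUnion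
          (Finset.mem_filter.2 ⟨Finset.mem_powerset.2 hsub, hlt⟩) hmem)
      · have hsub : t ⊆ S := fun i hi => (Finset.mem_insert.1 (ht hi)).resolve_left
          fun h => hjt (h ▸ hi)
        exact (ha t hsub hcard).congr (hupd t hsub)

/-- A continuous map from a compact space of covering dimension less than `finrank ℝ E` to `E` is
a uniform limit of nowhere vanishing continuous maps. -/
theorem CovDimLE.exists_dist_lt_ne_zero {Y E : Type*} [TopologicalSpace Y] [CompactSpace Y]
    [NormalSpace Y] [NormedAddCommGroup E] [NormedSpace ℝ E] [FiniteDimensional ℝ E] {d : ℕ}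
    (hY : CovDimLE Y d) (hd : d < Module.finrank ℝ E) (F : C(Y, E)) {δ : ℝ} (hδ : 0 < δ) :
    ∃ G : C(Y, E), (∀ y, dist (G y) (F y) < δ) ∧ ∀ y, G y ≠ 0 := by
  classical
  obtain ⟨𝒱, hVo, hVc, hVr, hVd⟩ := hY (range fun c => F ⁻¹' Metric.ball c (δ / 2))
    (by rintro _ ⟨c, rfl⟩; exact Metric.isOpen_ball.preimage F.continuous)
    (eq_univ_of_forall fun y => ⟨_, ⟨F y, rfl⟩, Metric.mem_ball_self (half_pos hδ)⟩)
  obtain ⟨𝒯, hT𝒱, hTfin, hTc⟩ : ∃ 𝒯 ⊆ 𝒱, 𝒯.Finite ∧ univ ⊆ ⋃₀ 𝒯 := by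
    obtain ⟨t, ht⟩ := isCompact_univ.elim_finite_subcover (fun V : 𝒱 => (V : Set Y))
      (fun V => hVo V V.2) (by rw [← sUnion_eq_iUnion, hVc])
    refine ⟨(↑) '' (t : Set 𝒱), by rintro _ ⟨V, -, rfl⟩; exact V.2, t.finite_toSet.image _, ?_⟩
    rwa [sUnion_image]
  have : Fintype 𝒯 := hTfin.fintype
  have hb : ∀ V : 𝒯, ∃ c, (V : Set Y) ⊆ F ⁻¹' Metric.ball c (δ / 2) := fun V => by
    obtain ⟨_, ⟨c, rfl⟩, h⟩ := hVr V (hT𝒱 V.2)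
    exact ⟨c, h⟩
  choose b hb using hb
  obtain ⟨a, hab, ha⟩ := exists_dist_lt_linearIndepOn b (half_pos hδ) Finset.univ
  obtain ⟨p, hp⟩ := PartitionOfUnity.exists_isSubordinate_of_locallyFinite (s := (univ : Set Y))
    isClosed_univ (fun V : 𝒯 => (V : Set Y)) (fun V => hVo V (hT𝒱 V.2))
    (locallyFinite_of_finite _) (by rwa [← sUnion_eq_iUnion])
  have hmem : ∀ V y, p V y ≠ 0 → y ∈ (V : Set Y) := fun V y h => hp V (subset_tsupport _ h)
  have hone : ∀ y, ∑ V, p V y = 1 := fun y => by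
    rw [← finsum_eq_sum_of_fintype]
    exact p.sum_eq_one (mem_univ y)
  refine ⟨⟨fun y => ∑ V, p V y • a V, by fun_prop⟩, fun y => ?_, fun y h0 => ?_⟩
  · have h := (convex_ball (F y) δ).finsum_mem (w := fun V => p V y) (z := a)
      (fun V => p.nonneg V y) (p.sum_eq_one (mem_univ y)) fun V hV => by
        have h1 := hab V
        have h2 := hb V (hmem V y hV)
        rw [mem_preimage, Metric.mem_ball, dist_comm] at h2
        rw [Metric.mem_ball]
        linarith [dist_triangle (a V) (b V) (F y)]
    rwa [finsum_eq_sum_of_fintype] at h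
  · set t : Finset 𝒯 := Finset.univ.filter fun V => p V y ≠ 0 with ht
    have hcard : t.card ≤ d + 1 := by
      obtain ⟨hfin, hle⟩ := hVd y
      refine le_trans ?_ hle
      rw [Nat.card_coe_set_eq, ← Finset.card_image_of_injective t Subtype.val_injective,
        ← ncard_coe_finset]
      refine ncard_le_ncard (fun V hV => ?_) hfin
      obtain ⟨W, hW, rfl⟩ := Finset.mem_image.1 hV
      exact ⟨hT𝒱 W.2, hmem W y (Finset.mem_filter.1 hW).2⟩
    have hli := linearIndepOn_finset_iff.1 (ha t (Finset.subset_univ _) (by omega))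
      (fun V => p V y) (by
        rw [ht, Finset.sum_filter_of_ne]
        · exact h0
        · intro V _ hV hz
          simp [hz] at hV)
    refine one_ne_zero (α := ℝ) ?_
    rw [← hone y]
    exact Finset.sum_eq_zero fun V _ => by
      by_contra hV
      exact hV (hli V (Finset.mem_filter.2 ⟨Finset.mem_univ V, hV⟩))

/-- A map into `g '' V` lifts continuously through `g` when `g` is injective on the compact
set `V`. -/
theorem IsCompact.exists_continuous_lift {X Y Z : Type*} [TopologicalSpace X] [T2Space X]
    [TopologicalSpace Y] [TopologicalSpace Z] {V : Set Y} (hV : IsCompact V) {g : Y → X}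
    (hg : Continuous g) (hinj : InjOn g V) (f : C(Z, X)) (hf : ∀ z, f z ∈ g '' V) :
    ∃ φ : C(Z, Y), ∀ z, φ z ∈ V ∧ g (φ z) = f z := by
  have : CompactSpace V := isCompact_iff_compactSpace.1 hV
  have hemb : IsEmbedding (V.domRestrict g) :=
    ((hg.comp continuous_subtype_val).isClosedEmbedding hinj.injective).isEmbedding
  have hf' : ∀ z, f z ∈ range (V.domRestrict g) := fun z => by rw [range_domRestrict]; exact hf z
  let e := hemb.toHomeomorph
  refine ⟨⟨fun z => e.symm ⟨f z, hf' z⟩, by fun_prop⟩, fun z => ⟨Subtype.coe_prop _, ?_⟩⟩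
  exact congrArg Subtype.val (e.apply_symm_apply ⟨f z, hf' z⟩)

/-- The iterates of a map injective on `U, …, T^{N-1}U` are injective on `U`. -/
theorem Set.InjOn.iterate_of_image {X : Type*} {T : X → X} {U : Set X} {N : ℕ}
    (h : ∀ i < N, InjOn T (T^[i] '' U)) {i : ℕ} (hi : i ≤ N) : InjOn T^[i] U := by
  induction i with
  | zero => exact injOn_id U
  | succ i ih =>
    rw [iterate_succ']
    exact (h i hi).comp (ih (by omega)) (mapsTo_image _ _)

/-- The solution of `d i = -E i` for `i < N` and `d i = d (i - k) - E i` for `i ≥ N`. -/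
def lagSolution {A : Type*} [AddGroup A] (k N : ℕ) (E : ℕ → A) : ℕ → A
  | i => if i < N ∨ ¬ i - k < i then -E i else lagSolution k N E (i - k) - E i

theorem lagSolution_of_lt {A : Type*} [AddGroup A] {k N : ℕ} (E : ℕ → A) {i : ℕ} (hi : i < N) :
    lagSolution k N E i = -E i := by
  rw [lagSolution, if_pos (Or.inl hi)]

theorem lagSolution_of_le {A : Type*} [AddGroup A] {k N : ℕ} (E : ℕ → A) {i : ℕ} (hk : 1 ≤ k)
    (hkN : k ≤ N) (hi : N ≤ i) :
    lagSolution k N E i = lagSolution k N E (i - k) - E i := by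
  rw [lagSolution, if_neg (by omega)]

theorem norm_lagSolution_le {A : Type*} [SeminormedAddCommGroup A] {k N : ℕ} {E : ℕ → A} {δ : ℝ}
    (hE : ∀ i, ‖E i‖ ≤ δ) (i : ℕ) : ‖lagSolution k N E i‖ ≤ (i + 1) * δ := by
  have hδ : 0 ≤ δ := (norm_nonneg _).trans (hE 0)
  induction i using Nat.strong_induction_on with
  | _ i ih =>
    rw [lagSolution]
    split_ifs with h
    · rw [norm_neg]
      nlinarith [hE i, (Nat.cast_nonneg i : (0 : ℝ) ≤ i)]
    · have hlt : i - k < i := by omega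
      have hcast : ((i - k : ℕ) : ℝ) + 1 ≤ i := by exact_mod_cast hlt
      nlinarith [norm_sub_le (lagSolution k N E (i - k)) (E i), ih _ hlt, hE i]

theorem mem_Gk_iff {X : Type*} {T : X → X} {k : ℕ} {p : X × X} :
    p ∈ Gk T k ↔ p.2 = T^[k] p.1 ∧
      ∀ i j : ℕ, i ≤ k → j ≤ k → i ≠ j → T^[i] p.1 ≠ T^[j] p.1 := Iff.rfl

/-- Under the disjointness hypotheses on the orbits of `U` and `V`, membership of
`(x, y) ∈ U × V` in `G_{k,l}` reduces to `T^{l+k} x = T^l y`. -/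
theorem mem_Gkl_iff {X : Type*} {T : X → X} {k l : ℕ} {U V : Set X}
    (hdisUU : ∀ i j : ℕ, i < l + k → j < l + k → i ≠ j → Disjoint (T^[i] '' U) (T^[j] '' U))
    (hdisUV : ∀ i j : ℕ, i < l + k → j ≤ l → Disjoint (T^[i] '' U) (T^[j] '' V))
    {x y : X} (hx : x ∈ U) (hy : y ∈ V) :
    (x, y) ∈ Gkl T k l ↔ T^[l] y = T^[l + k] x := by
  have hGk : (T^[l] x, T^[l] y) ∈ Gk T k ↔ T^[l] y = T^[l + k] x := by
    have hadd : ∀ i, T^[i] (T^[l] x) = T^[l + i] x := fun i => by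
      rw [← iterate_add_apply, add_comm]
    simp only [mem_Gk_iff, hadd]
    refine and_iff_left_of_imp fun hxy => ?_
    have hne : ∀ i j : ℕ, j ≤ k → i < j → T^[l + i] x ≠ T^[l + j] x := fun i j hj hij => by
      rcases hj.eq_or_lt with rfl | hj
      · rw [← hxy]
        exact (hdisUV (l + i) l (by omega) le_rfl).ne_of_mem (mem_image_of_mem _ hx)
          (mem_image_of_mem _ hy)
      · exact (hdisUU (l + i) (l + j) (by omega) (by omega) (by omega)).ne_of_mem
          (mem_image_of_mem _ hx) (mem_image_of_mem _ hx)
    intro i j hi hj hij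
    rcases hij.lt_or_gt with h | h
    · exact hne i j hj h
    · exact (hne j i hi h).symm
  rw [Gkl]
  split_ifs with hl
  · subst hl
    exact hGk
  · simp only [Prod.map_iterate, mem_ofPred_eq, Prod.map_apply, hGk]
    refine and_iff_left_of_imp fun _ hG => ?_
    have h : T^[l - 1] y = T^[l - 1 + k] x := by
      rw [add_comm, iterate_add_apply]; exact hG.1
    exact (hdisUV (l - 1 + k) (l - 1) (by omega) (by omega)).ne_of_mem
      (mem_image_of_mem _ hx) (mem_image_of_mem _ hy) h.symm

/-- If `U, V ⊆ X` are compact with `dim U ≤ n`, `T^{l+k}U = T^l V`, the sets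
`U, …, T^{l+k-1}U, V, …, TⁿV` pairwise disjoint (`0 ≤ l < l+k ≤ n`), and `T` injective on
`U, …, T^{l+k-1}U, V, …, T^{n-1}V`, then the set of `f ∈ C(X, ℝ)` observing `T` on
`(U × V) ∩ G_{k,l}` in `n` steps is open and dense. -/
theorem stmt17 {X : Type*} [MetricSpace X] [CompactSpace X]
    (T : X → X) (hTcont : Continuous T) (n k l : ℕ)
    (hk : 1 ≤ k) (hlkn : l + k ≤ n)
    (U V : Set X) (hUc : IsCompact U) (hVc : IsCompact V)
    (hdU : CovDimLE U n)
    (hUV : T^[l + k] '' U = T^[l] '' V)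
    (hdisUU : ∀ i j : ℕ, i < l + k → j < l + k → i ≠ j →
      Disjoint (T^[i] '' U) (T^[j] '' U))
    (hdisVV : ∀ i j : ℕ, i ≤ n → j ≤ n → i ≠ j →
      Disjoint (T^[i] '' V) (T^[j] '' V))
    (hdisUV : ∀ i j : ℕ, i < l + k → j ≤ n → Disjoint (T^[i] '' U) (T^[j] '' V))
    (hinjU : ∀ i : ℕ, i < l + k → Set.InjOn T (T^[i] '' U))
    (hinjV : ∀ i : ℕ, i < n → Set.InjOn T (T^[i] '' V)) :
    IsOpen {f : C(X, ℝ) | ∀ x ∈ U, ∀ y ∈ V, (x, y) ∈ Gkl T k l →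
        ∃ i : ℕ, i ≤ n ∧ f (T^[i] x) ≠ f (T^[i] y)} ∧
    Dense {f : C(X, ℝ) | ∀ x ∈ U, ∀ y ∈ V, (x, y) ∈ Gkl T k l →
        ∃ i : ℕ, i ≤ n ∧ f (T^[i] x) ≠ f (T^[i] y)} := by
  have : CompactSpace U := isCompact_iff_compactSpace.1 hUc
  have hcont : ∀ i, Continuous T^[i] := fun i => hTcont.iterate i
  have hinjU' : ∀ i ≤ l + k, InjOn T^[i] U := fun i => InjOn.iterate_of_image hinjU
  have hinjV' : ∀ i ≤ n, InjOn T^[i] V := fun i => InjOn.iterate_of_image hinjV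
  obtain ⟨φ, hφ⟩ := hVc.exists_continuous_lift (hcont l) (hinjV' l (by omega))
    ⟨fun x : U => T^[l + k] x, (hcont _).comp continuous_subtype_val⟩
    fun x => hUV ▸ mem_image_of_mem _ x.2
  simp only [ContinuousMap.coe_mk] at hφ
  have hφinj : Injective φ := fun x y h => Subtype.ext <|
    hinjU' (l + k) le_rfl x.2 y.2 (by rw [← (hφ x).2, h, (hφ y).2])
  have hset : {f : C(X, ℝ) | ∀ x ∈ U, ∀ y ∈ V, (x, y) ∈ Gkl T k l →
      ∃ i : ℕ, i ≤ n ∧ f (T^[i] x) ≠ f (T^[i] y)} =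
      {f : C(X, ℝ) | ∀ x : U, ∃ i : ℕ, i ≤ n ∧ f (T^[i] x) ≠ f (T^[i] (φ x))} := by
    have hG := fun {x y : X} => mem_Gkl_iff (x := x) (y := y) hdisUU
      fun i j hi hj => hdisUV i j hi (by omega)
    ext f
    refine ⟨fun hf x => hf x x.2 _ (hφ x).1 ((hG x.2 (hφ x).1).2 (hφ x).2),
      fun hf x hx y hy hxy => ?_⟩
    have : φ ⟨x, hx⟩ = y := hinjV' l (by omega) (hφ _).1 hy
      ((hφ _).2.trans ((hG hx hy).1 hxy).symm)
    simpa only [this] using hf ⟨x, hx⟩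
  rw [hset]
  constructor
  · rw [← isClosed_compl_iff]
    have hcl : IsClosed {q : U × C(X, ℝ) | ∀ i ≤ n, q.2 (T^[i] q.1) = q.2 (T^[i] (φ q.1))} := by
      simp only [ofPred_forall]
      refine isClosed_iInter fun i => isClosed_iInter fun _ => isClosed_eq ?_ ?_
      · exact continuous_snd.eval ((hcont i).comp (continuous_subtype_val.comp continuous_fst))
      · exact continuous_snd.eval ((hcont i).comp (φ.continuous.comp continuous_fst))
    convert isClosedMap_snd_of_compactSpace _ hcl using 1
    ext f
    simp
  · refine Metric.dense_iff.2 fun f r hr => ?_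
    let δ : ℝ := r / (n + 2)
    have hδ : 0 < δ := by positivity
    have hδr : (n + 1) * δ < r := by
      simp only [δ]
      rw [← mul_div_assoc, div_lt_iff₀ (by positivity)]
      nlinarith
    let F : C(U, Fin (n + 1) → ℝ) := ⟨fun x i => f (T^[i] x) - f (T^[i] (φ x)),
      continuous_pi fun i => (f.continuous.comp ((hcont i).comp continuous_subtype_val)).sub
        (f.continuous.comp ((hcont i).comp φ.continuous))⟩
    obtain ⟨G, hGF, hG0⟩ := hdU.exists_dist_lt_ne_zero (by simp) F hδ
    let E : ℕ → C(U, ℝ) := fun i => if h : i < n + 1 then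
      ⟨fun x => G x ⟨i, h⟩ - F x ⟨i, h⟩, by fun_prop⟩ else 0
    have hEapp : ∀ (i : Fin (n + 1)) x, E i x = G x i - F x i := fun i x => by
      simp only [E, dif_pos i.2]; rfl
    have hE : ∀ i, ‖E i‖ ≤ δ := fun i => by
      refine (ContinuousMap.norm_le _ hδ.le).2 fun x => ?_
      by_cases h : i < n + 1
      · rw [hEapp ⟨i, h⟩ x, ← dist_eq_norm]
        exact (dist_le_pi_dist (G x) (F x) ⟨i, h⟩).trans (hGF x).le
      · simp only [E, dif_neg h, ContinuousMap.zero_apply, norm_zero, hδ.le]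
    let d := lagSolution k (l + k) E
    let e : (Fin (l + k) × U) ⊕ (Fin (n + 1) × U) → X :=
      Sum.elim (fun q => T^[q.1] q.2) (fun q => T^[q.1] (φ q.2))
    have he : IsClosedEmbedding e := by
      refine Continuous.isClosedEmbedding ?_ ?_
      · refine (continuous_prod_of_discrete_left.2 fun i => ?_).sumElim
          (continuous_prod_of_discrete_left.2 fun i => ?_)
        · exact (hcont i).comp continuous_subtype_val
        · exact (hcont i).comp φ.continuous
      · refine Injective.sumElim ?_ ?_ ?_
        · rintro ⟨i, x⟩ ⟨j, y⟩ h
          obtain rfl : i = j := by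
            by_contra hij
            exact (hdisUU i j i.2 j.2 (by omega)).ne_of_mem (mem_image_of_mem _ x.2)
              (mem_image_of_mem _ y.2) h
          rw [Subtype.ext (hinjU' i i.2.le x.2 y.2 h)]
        · rintro ⟨i, x⟩ ⟨j, y⟩ h
          obtain rfl : i = j := by
            by_contra hij
            exact (hdisVV i j (by omega) (by omega) (by omega)).ne_of_mem
              (mem_image_of_mem _ (hφ x).1) (mem_image_of_mem _ (hφ y).1) h
          rw [hφinj (hinjV' i (by omega) (hφ x).1 (hφ y).1 h)]
        · rintro ⟨i, x⟩ ⟨j, y⟩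
          exact (hdisUV i j i.2 (by omega)).ne_of_mem (mem_image_of_mem _ x.2)
            (mem_image_of_mem _ (hφ y).1)
    let D : C((Fin (l + k) × U) ⊕ (Fin (n + 1) × U), ℝ) :=
      ⟨Sum.elim 0 (fun q => d q.1 q.2), continuous_zero.sumElim
        (continuous_prod_of_discrete_left.2 fun i => (d i).continuous)⟩
    have hD : ‖D‖ ≤ (n + 1) * δ := by
      refine (ContinuousMap.norm_le _ (by positivity)).2 ?_
      rintro (q | ⟨i, x⟩)
      · simpa [D] using mul_nonneg (by positivity) hδ.le
      · refine ((d i).norm_coe_le_norm x).trans ((norm_lagSolution_le hE i).trans ?_)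
        gcongr
        exact_mod_cast Nat.lt_succ_iff.1 i.2
    obtain ⟨g, hgn, hge⟩ := BoundedContinuousFunction.exists_extension_norm_eq_of_isClosedEmbedding
      (BoundedContinuousFunction.mkOfCompact D) he
    have hgU : ∀ i < l + k, ∀ x : U, g (T^[i] x) = 0 := fun i hi x =>
      congrFun hge (Sum.inl (⟨i, hi⟩, x))
    have hgV : ∀ i ≤ n, ∀ x : U, g (T^[i] (φ x)) = d i x := fun i hi x =>
      congrFun hge (Sum.inr (⟨i, Nat.lt_succ_iff.2 hi⟩, x))
    refine ⟨f + g.toContinuousMap, ?_, fun x => ?_⟩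
    · rw [mem_ball_iff_norm, add_sub_cancel_left]
      refine lt_of_le_of_lt ?_ hδr
      rw [BoundedContinuousFunction.norm_toContinuousMap_eq, hgn,
        BoundedContinuousFunction.norm_mkOfCompact]
      exact hD
    · by_contra! hx
      refine hG0 x (funext fun i => ?_)
      have hi : (i : ℕ) ≤ n := Nat.lt_succ_iff.1 i.2
      have hxi := hx i hi
      have hEi := hEapp i x
      have hFi : F x i = f (T^[i] x) - f (T^[i] (φ x)) := rfl
      simp only [ContinuousMap.add_apply, BoundedContinuousFunction.coe_toContinuousMap,
        hgV i hi] at hxi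
      rcases lt_or_ge (i : ℕ) (l + k) with h | h
      · have hdi : d i x = -E i x := by
          simp only [d, lagSolution_of_lt E h, ContinuousMap.neg_apply]
        rw [hgU i h] at hxi
        rw [Pi.zero_apply]
        linarith
      · have hdi : d i x = d (i - k) x - E i x := by
          simp only [d, lagSolution_of_le E hk (by omega : k ≤ l + k) h, ContinuousMap.sub_apply]
        have horb : T^[i] x = T^[i - k] (φ x) := by
          obtain ⟨m, hm⟩ := Nat.exists_eq_add_of_le h
          rw [hm, show l + k + m - k = m + l by omega, show l + k + m = m + (l + k) by omega,
            iterate_add_apply T m, iterate_add_apply T m, (hφ x).2]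
        rw [horb, hgV (i - k) (by omega)] at hxi
        rw [horb] at hFi
        rw [Pi.zero_apply]
        linarith
end
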